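/- Let f ∈ E_rad be nonzero, set f̂ = f^{*φ_f}, and for nonzero φ ∈ Φ_rad set J_{f^*}(φ) = H(f^{*φ}) + ½∫_{ℝ³}|∇φ − ∇φ_{f^{*φ}}|² dx. Then H(f) ≥ J_{f^*}(φ_f) ≥ H(f̂). Moreover H(f) = H(f̂) if and only if f = f̂. -/

import Mathlib

noncomputable section

open MeasureTheory Real Filter Set Topology
open scoped ENNReal NNReal

abbrev E3 : Type := EuclideanSpace ℝ (Fin 3)
abbrev Phase : Type := E3 × E3

/-- Spherical symmetry: invariance under all rotations of `ℝ³` acting jointly on `x` and `v`. -/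
def SphSym (f : Phase → ℝ) : Prop :=
  ∀ R : E3 ≃ₗᵢ[ℝ] E3, LinearMap.det (R.toLinearEquiv : E3 →ₗ[ℝ] E3) = 1 →
    ∀ z : Phase, f (R z.1, R z.2) = f z

/-- `|x × v|²`, via the Lagrange identity. -/
def ellOf (z : Phase) : ℝ := ‖z.1‖ ^ 2 * ‖z.2‖ ^ 2 - (inner ℝ z.1 z.2 : ℝ) ^ 2

/-- Spatial density. -/
def rhoF (f : Phase → ℝ) (x : E3) : ℝ := ∫ v : E3, f (x, v)

/-- Poisson field. -/
def phiF (f : Phase → ℝ) (x : E3) : ℝ := - ∫ y : E3, rhoF f y / (4 * π * ‖x - y‖)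

/-- Radial representation of the Poisson field. -/
def phiRad (f : Phase → ℝ) (r : ℝ) : ℝ :=
  phiF f (r • (EuclideanSpace.single (0 : Fin 3) (1:ℝ)))

def mass (f : Phase → ℝ) : ℝ := ∫ z : Phase, f z

def kineticE (f : Phase → ℝ) : ℝ := ∫ z : Phase, ‖z.2‖ ^ 2 * f z

def gradPhi (f : Phase → ℝ) (x : E3) : E3 := gradient (phiF f) x

def fieldSq (f : Phase → ℝ) : ℝ := ∫ x : E3, ‖gradPhi f x‖ ^ 2

/-- `L²` distance between the force fields of `f` and `g`. -/
def fieldDist (f g : Phase → ℝ) : ℝ :=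
  Real.sqrt (∫ x : E3, ‖gradPhi f x - gradPhi g x‖ ^ 2)

/-- The Hamiltonian. -/
def Ham (f : Phase → ℝ) : ℝ := kineticE f / 2 - fieldSq f / 2

/-- The norm of the energy space. -/
def eNormE (f : Phase → ℝ) : ℝ≥0∞ :=
  eLpNorm f 1 volume + eLpNorm f ⊤ volume +
    ∫⁻ z : Phase, (‖z.2‖₊ : ℝ≥0∞) ^ 2 * (‖f z‖₊ : ℝ≥0∞)

def memE (f : Phase → ℝ) : Prop := Measurable f ∧ (∀ z, 0 ≤ f z) ∧ eNormE f < ⊤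

def memErad (f : Phase → ℝ) : Prop := memE f ∧ SphSym f

/-- Density of the measure `ν_ℓ`. -/
def nuDens (ℓ : ℝ) (p : ℝ × ℝ) : ℝ≥0∞ :=
  if 0 < p.1 ∧ ℓ < p.1 ^ 2 * p.2 ^ 2 then
    ENNReal.ofReal (4 * π ^ 2 * p.1 * |p.2| / Real.sqrt (p.1 ^ 2 * p.2 ^ 2 - ℓ))
  else 0

def nuMeas (ℓ : ℝ) : Measure (ℝ × ℝ) := volume.withDensity (nuDens ℓ)

/-- Representative phase point with `|x| = r`, `|v| = |u|`, `|x×v|² = ℓ` and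
`x·v = sign u · √(r²u²-ℓ)`. -/
def radPoint (r u ℓ : ℝ) : Phase :=
  (r • (EuclideanSpace.single (0 : Fin 3) (1:ℝ)),
   (Real.sign u * Real.sqrt (r ^ 2 * u ^ 2 - ℓ) / r) • (EuclideanSpace.single (0 : Fin 3) (1:ℝ))
     + (Real.sqrt ℓ / r) • (EuclideanSpace.single (1 : Fin 3) (1:ℝ)))

/-- Distribution function of `f` at kinetic momentum `ℓ`. -/
def muDist (f : Phase → ℝ) (s ℓ : ℝ) : ℝ≥0∞ :=
  nuMeas ℓ {p : ℝ × ℝ | s < f (radPoint p.1 p.2 ℓ)}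

/-- `g ∈ Eq(f)` : `g` is nonnegative, spherically symmetric and equimeasurable to `f`
at (almost) every kinetic momentum `ℓ`. -/
def EqMeas (f g : Phase → ℝ) : Prop :=
  (∀ z, 0 ≤ g z) ∧ SphSym g ∧
    ∀ s : ℝ, 0 < s →
      ∀ᵐ ℓ ∂(volume.restrict (Ioi (0:ℝ))), muDist g s ℓ = muDist f s ℓ

/-- Schwarz symmetrization of `f` at fixed `ℓ`. -/
def schwarz (f : Phase → ℝ) (t ℓ : ℝ) : ℝ :=
  if ENNReal.ofReal t < muDist f 0 ℓ then
    sSup {s : ℝ | 0 ≤ s ∧ ENNReal.ofReal t < muDist f s ℓ}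
  else 0

/-- Effective potential. -/
def psiPot (φ : ℝ → ℝ) (ℓ r : ℝ) : ℝ := φ r + ℓ / (2 * r ^ 2)

def eMinPot (φ : ℝ → ℝ) (ℓ : ℝ) : ℝ := sInf (psiPot φ ℓ '' Ioi 0)

def r1Pot (φ : ℝ → ℝ) (e ℓ : ℝ) : ℝ := sInf {r : ℝ | 0 < r ∧ psiPot φ ℓ r < e}

def r2Pot (φ : ℝ → ℝ) (e ℓ : ℝ) : ℝ := sSup {r : ℝ | 0 < r ∧ psiPot φ ℓ r < e}

/-- The Jacobian `a_φ(e, ℓ)` (meaningful for `e < 0`). -/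
def aPot (φ : ℝ → ℝ) (e ℓ : ℝ) : ℝ :=
  8 * π ^ 2 * Real.sqrt 2 * ∫ r in Ioi (0:ℝ), Real.sqrt (max (e - psiPot φ ℓ r) 0)

/-- Inverse of the bijection `e ↦ a_φ(e,ℓ)` from `(e_{φ,ℓ},0)` onto `(0,∞)`. -/
def aPotInv (φ : ℝ → ℝ) (s ℓ : ℝ) : ℝ :=
  sSup {e : ℝ | eMinPot φ ℓ < e ∧ e < 0 ∧ aPot φ e ℓ < s}

/-- Microscopic energy w.r.t. the Poisson field of `g`. -/
def microE (g : Phase → ℝ) (z : Phase) : ℝ := ‖z.2‖ ^ 2 / 2 + phiF g z.1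

/-- Rearrangement of `f` with respect to the microscopic energy of the field of `g`. -/
def rearr (f g : Phase → ℝ) (z : Phase) : ℝ :=
  if microE g z < 0 then
    schwarz f (aPot (phiRad g) (microE g z) (ellOf z)) (ellOf z)
  else 0

/-- Assumption (A). -/
structure AssumptionA (Q : Phase → ℝ) (F : ℝ → ℝ → ℝ) (e₀ : ℝ) : Prop where
  contQ : Continuous Q
  nonneg : ∀ z, 0 ≤ Q z
  nonzero : Q ≠ 0
  cpt : HasCompactSupport Q
  sph : SphSym Q
  eqF : ∀ z : Phase, Q z = F (microE Q z) (ellOf z)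
  Fnonneg : ∀ e ℓ, 0 ≤ ℓ → 0 ≤ F e ℓ
  Fcont : ContinuousOn (fun p : ℝ × ℝ => F p.1 p.2) {p : ℝ × ℝ | 0 ≤ p.2}
  e₀neg : e₀ < 0
  Fsupp : ∀ e ℓ, 0 ≤ ℓ → 0 < F e ℓ → e < e₀
  FC1 : ContDiffOn ℝ 1 (fun p : ℝ × ℝ => F p.1 p.2) {p : ℝ × ℝ | 0 ≤ p.2 ∧ 0 < F p.1 p.2}
  FeNeg : ∀ e ℓ, 0 ≤ ℓ → 0 < F e ℓ → deriv (fun e' => F e' ℓ) e < 0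

/-- The reduced functional `J_{f^*}(φ_g) = H(f^{*φ_g}) + ½|∇φ_g − ∇φ_{f^{*φ_g}}|²`. -/
def Jred (f g : Phase → ℝ) : ℝ :=
  Ham (rearr f g) + (∫ x : E3, ‖gradPhi g x - gradPhi (rearr f g) x‖ ^ 2) / 2

def distL1 (f g : Phase → ℝ) : ℝ := ∫ z : Phase, |f z - g z|

def distL1v (f g : Phase → ℝ) : ℝ := ∫ z : Phase, ‖z.2‖ ^ 2 * |f z - g z|



lemma lint_sq (a : ℝ) (ha : 0 ≤ a) (k : ℝ → ℝ≥0∞) :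
    ∫⁻ σ in Ioi (0:ℝ), k σ = ∫⁻ ρ in Ioi a, ENNReal.ofReal (2 * ρ) * k (ρ ^ 2 - a ^ 2) := by
  have him : (fun ρ : ℝ => ρ ^ 2 - a ^ 2) '' Ioi a = Ioi 0 := by
    ext σ
    simp only [mem_image, mem_Ioi]
    constructor
    · rintro ⟨ρ, h, rfl⟩
      nlinarith
    · intro h
      refine ⟨√(σ + a ^ 2), ?_, ?_⟩
      · apply Real.lt_sqrt_of_sq_lt; linarith
      · rw [Real.sq_sqrt (by positivity)]; ring
  rw [← him, lintegral_image_eq_lintegral_abs_deriv_mul (f' := fun ρ => 2 * ρ) measurableSet_Ioi]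
  · refine setLIntegral_congr_fun measurableSet_Ioi ?_
    intro ρ hρ
    have : 0 < ρ := lt_of_le_of_lt ha hρ
    simp only [abs_of_pos (by positivity : 0 < 2 * ρ)]
  · intro x hx
    have := ((hasDerivAt_pow 2 x).sub_const (a ^ 2)).hasDerivWithinAt (s := Ioi a)
    simpa using this
  · intro x hx y hy h
    simp only [mem_Ioi] at hx hy
    have h1 : x ^ 2 = y ^ 2 := by simpa using h
    exact (sq_eq_sq₀ (by linarith) (by linarith)).1 h1

lemma lint_plane (k : ℝ → ℝ≥0∞) (hk : Measurable k) :
    ∫⁻ p : ℝ × ℝ, k (p.1 ^ 2 + p.2 ^ 2) = ENNReal.ofReal π * ∫⁻ σ in Ioi (0:ℝ), k σ := by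
  rw [← lintegral_comp_polarCoord_symm, lint_sq 0 le_rfl k]
  have : ∀ p : ℝ × ℝ, (polarCoord.symm p).1 ^ 2 + (polarCoord.symm p).2 ^ 2 = p.1 ^ 2 := by
    intro p
    simp only [polarCoord_symm_apply]
    nlinarith [Real.sin_sq_add_cos_sq p.2]
  simp only [this, polarCoord_target, smul_eq_mul]
  rw [Measure.volume_eq_prod, ← Measure.prod_restrict, lintegral_prod _ (by fun_prop)]
  simp only [lintegral_const, Measure.restrict_apply MeasurableSet.univ, univ_inter, Real.volume_Ioo]
  rw [← lintegral_const_mul' _ _ ENNReal.ofReal_ne_top]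
  refine setLIntegral_congr_fun measurableSet_Ioi ?_
  intro r hr
  simp only [mem_Ioi] at hr
  simp only [ne_eq, OfNat.ofNat_ne_zero, not_false_eq_true, zero_pow, sub_zero]
  rw [mul_comm, ← mul_assoc, ← mul_assoc, ← ENNReal.ofReal_mul (by linarith [pi_pos]),
    ← ENNReal.ofReal_mul pi_pos.le]
  congr 2; ring

lemma lint_cyl (h : ℝ → ℝ → ℝ≥0∞) (hh : Measurable (Function.uncurry h)) :
    ∫⁻ v : E3, h (v 0) (v 1 ^ 2 + v 2 ^ 2) =
      ENNReal.ofReal π * ∫⁻ w : ℝ, ∫⁻ σ in Ioi (0:ℝ), h w σ := by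
  have e1 := (PiLp.volume_preserving_ofLp (Fin 3)).lintegral_comp (f := fun y : Fin 3 → ℝ => h (y 0) (y 1 ^ 2 + y 2 ^ 2))
    (by
      have : Measurable fun y : Fin 3 → ℝ => (y 0, y 1 ^ 2 + y 2 ^ 2) := by fun_prop
      exact hh.comp this)
  have e2 := (volume_preserving_piFinSuccAbove (fun _ : Fin 3 => ℝ) 0).lintegral_comp
    (f := fun y : ℝ × (Fin 2 → ℝ) => h y.1 (y.2 0 ^ 2 + y.2 1 ^ 2))
    (by
      have : Measurable fun y : ℝ × (Fin 2 → ℝ) => (y.1, y.2 0 ^ 2 + y.2 1 ^ 2) := by fun_prop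
      exact hh.comp this)
  have e3 : ∀ w : ℝ, ∫⁻ y : Fin 2 → ℝ, h w (y 0 ^ 2 + y 1 ^ 2) = 
      ENNReal.ofReal π * ∫⁻ σ in Ioi (0:ℝ), h w σ := by
    intro w
    have hw : Measurable (h w) := hh.comp (by fun_prop : Measurable fun σ : ℝ => (w, σ))
    rw [← lint_plane _ hw]
    exact (volume_preserving_finTwoArrow ℝ).lintegral_comp (f := fun p : ℝ × ℝ => h w (p.1 ^ 2 + p.2 ^ 2))
      (hw.comp (by fun_prop))
  calc _ = _ := e1
    _ = _ := e2
    _ = ∫⁻ w : ℝ, ∫⁻ y : Fin 2 → ℝ, h w (y 0 ^ 2 + y 1 ^ 2) := by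
      rw [Measure.volume_eq_prod, lintegral_prod]
      have : Measurable fun y : ℝ × (Fin 2 → ℝ) => (y.1, y.2 0 ^ 2 + y.2 1 ^ 2) := by fun_prop
      exact (hh.comp this).aemeasurable
    _ = _ := by
      simp_rw [e3]
      rw [lintegral_const_mul' _ _ ENNReal.ofReal_ne_top]

lemma norm_sq_E3 (v : E3) : ‖v‖ ^ 2 = v 0 ^ 2 + (v 1 ^ 2 + v 2 ^ 2) := by
  rw [EuclideanSpace.norm_sq_eq, Fin.sum_univ_three]
  simp [add_assoc]

/-- axial integration -/
lemma lint_ax (h : ℝ → ℝ → ℝ≥0∞) (hh : Measurable (Function.uncurry h)) :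
    ∫⁻ v : E3, h (v 0) ‖v‖ =
      ∫⁻ ρ in Ioi (0:ℝ), ENNReal.ofReal (2 * π * ρ) * ∫⁻ w in Ioo (-ρ) ρ, h w ρ := by
  have hn : ∀ v : E3, ‖v‖ = √ (v 0 ^ 2 + (v 1 ^ 2 + v 2 ^ 2)) := by
    intro v; rw [← norm_sq_E3, Real.sqrt_sq (norm_nonneg _)]
  simp_rw [hn]
  rw [lint_cyl (fun w σ => h w √(w ^ 2 + σ))
    (by
      have : Measurable fun y : ℝ × ℝ => (y.1, √(y.1 ^ 2 + y.2)) := by fun_prop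
      exact hh.comp this)]
  have e1 : ∀ w : ℝ, ∫⁻ σ in Ioi (0:ℝ), h w √(w ^ 2 + σ) =
      ∫⁻ ρ, (Ioi |w|).indicator (fun ρ => ENNReal.ofReal (2 * ρ) * h w ρ) ρ := by
    intro w
    rw [lint_sq |w| (abs_nonneg w), lintegral_indicator measurableSet_Ioi]
    refine setLIntegral_congr_fun measurableSet_Ioi ?_
    intro ρ hρ
    simp only [mem_Ioi] at hρ
    have : 0 ≤ ρ := (abs_nonneg w).trans hρ.le
    simp only [sq_abs, add_sub_cancel, Real.sqrt_sq this]
  simp_rw [e1]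
  have hset : MeasurableSet {p : ℝ × ℝ | |p.1| < p.2} := measurableSet_lt (by fun_prop) (by fun_prop)
  rw [lintegral_lintegral_swap, ← lintegral_const_mul' _ _ ENNReal.ofReal_ne_top,
    ← lintegral_indicator measurableSet_Ioi]
  · refine lintegral_congr fun ρ => ?_
    by_cases hρ : 0 < ρ
    · rw [indicator_of_mem (by exact hρ), ← lintegral_const_mul' _ _ ENNReal.ofReal_ne_top,
        ← lintegral_const_mul' _ _ ENNReal.ofReal_ne_top, ← lintegral_indicator measurableSet_Ioo]
      refine lintegral_congr fun w => ?_
      by_cases hw : |w| < ρ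
      · rw [indicator_of_mem (by exact hw), indicator_of_mem (by exact abs_lt.1 hw), ← mul_assoc,
          ← ENNReal.ofReal_mul pi_pos.le]
        congr 2; ring
      · rw [indicator_of_notMem (by exact hw), indicator_of_notMem (by exact fun h => hw (abs_lt.2 h)), mul_zero]
    · rw [indicator_of_notMem (by exact hρ)]
      have : ∀ w : ℝ, (Ioi |w|).indicator (fun ρ => ENNReal.ofReal (2 * ρ) * h w ρ) ρ = 0 := by
        intro w
        exact indicator_of_notMem (by simp only [mem_Ioi]; linarith [abs_nonneg w]) _
      rw [lintegral_congr this]; simp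
  · have : Measurable (Function.uncurry h) := hh
    have h2 : Measurable fun p : ℝ × ℝ => ENNReal.ofReal (2 * p.2) * h p.1 p.2 := by
      exact Measurable.mul (by fun_prop) hh
    exact (h2.indicator hset).aemeasurable

lemma lint_rad (h : ℝ → ℝ≥0∞) (hh : Measurable h) :
    ∫⁻ x : E3, h ‖x‖ = ∫⁻ r in Ioi (0:ℝ), ENNReal.ofReal (4 * π * r ^ 2) * h r := by
  rw [lint_ax (fun _ ρ => h ρ) (hh.comp measurable_snd)]
  refine setLIntegral_congr_fun measurableSet_Ioi ?_
  intro r hr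
  simp only [mem_Ioi] at hr
  simp only [lintegral_const, Measure.restrict_apply MeasurableSet.univ, univ_inter, Real.volume_Ioo]
  rw [mul_comm (h r), ← mul_assoc, ← ENNReal.ofReal_mul (by positivity)]
  congr 2; ring


abbrev e0 : E3 := EuclideanSpace.single (0 : Fin 3) (1:ℝ)
abbrev e1 : E3 := EuclideanSpace.single (1 : Fin 3) (1:ℝ)

lemma exists_rot (x v x' v' : E3) (hx : ‖x‖ = ‖x'‖) (hv : ‖v‖ = ‖v'‖)
    (hi : inner ℝ x v = inner ℝ x' v') :
    ∃ R : E3 ≃ₗᵢ[ℝ] E3, LinearMap.det (R.toLinearEquiv : E3 →ₗ[ℝ] E3) = 1 ∧ R x = x' ∧ R v = v' := by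
  let R1 : E3 ≃ₗᵢ[ℝ] E3 := (ℝ ∙ (x - x'))ᗮ.reflection
  have h1 : R1 x = x' := Submodule.reflection_sub hx
  let R2 : E3 ≃ₗᵢ[ℝ] E3 := (ℝ ∙ (R1 v - v'))ᗮ.reflection
  have h2 : R2 (R1 v) = v' := Submodule.reflection_sub (by rw [← hv]; simp)
  have h3 : R2 x' = x' := by
    apply Submodule.reflection_mem_subspace_eq_self
    rw [Submodule.mem_orthogonal_singleton_iff_inner_left, inner_sub_right, ← hi]
    nth_rw 1 [← h1]
    rw [LinearIsometryEquiv.inner_map_map, sub_self]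
  let R := R1.trans R2
  have hRx : R x = x' := by simp [R, h1, h3]
  have hRv : R v = v' := by simp [R, h2]
  have hdet : LinearMap.det (R.toLinearEquiv : E3 →ₗ[ℝ] E3) = 1 ∨
      LinearMap.det (R.toLinearEquiv : E3 →ₗ[ℝ] E3) = -1 := by
    have hc : (R.toLinearEquiv : E3 →ₗ[ℝ] E3) =
        (R2.toLinearEquiv : E3 →ₗ[ℝ] E3) ∘ₗ (R1.toLinearEquiv : E3 →ₗ[ℝ] E3) := rfl
    have d1 : LinearMap.det (R1.toLinearEquiv : E3 →ₗ[ℝ] E3) = _ :=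
      Submodule.det_reflection (K := (ℝ ∙ (x - x'))ᗮ)
    have d2 : LinearMap.det (R2.toLinearEquiv : E3 →ₗ[ℝ] E3) = _ :=
      Submodule.det_reflection (K := (ℝ ∙ (R1 v - v'))ᗮ)
    rw [hc, LinearMap.det_comp, d1, d2, ← pow_add]
    exact neg_one_pow_eq_or ℝ _
  rcases hdet with h | h
  · exact ⟨R, h, hRx, hRv⟩
  · have : ∃ n : E3, n ≠ 0 ∧ n ∈ (Submodule.span ℝ {x', v'})ᗮ := by
      have hfr : Module.finrank ℝ (Submodule.span ℝ {x', v'}) ≤ 2 := by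
        have := finrank_span_le_card (R := ℝ) ({x', v'} : Set E3)
        refine this.trans ?_
        rw [Set.toFinset_card]
        have h5 := Set.encard_insert_le ({v'} : Set E3) x'
        rw [← Nat.card_eq_fintype_card, Nat.card_coe_set_eq]
        exact Set.ncard_insert_le _ _ |>.trans (by simp)
      have hadd := Submodule.finrank_add_finrank_orthogonal (Submodule.span ℝ {x', v'})
      rw [finrank_euclideanSpace_fin] at hadd
      have hne : (Submodule.span ℝ {x', v'})ᗮ ≠ ⊥ := by
        intro hb
        rw [hb, finrank_bot] at hadd
        omega
      obtain ⟨n, hn, hn0⟩ := Submodule.exists_mem_ne_zero_of_ne_bot hne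
      exact ⟨n, hn0, hn⟩
    obtain ⟨n, hn0, hn⟩ := this
    let R3 : E3 ≃ₗᵢ[ℝ] E3 := (ℝ ∙ n)ᗮ.reflection
    have hfix : ∀ y ∈ ({x', v'} : Set E3), R3 y = y := by
      intro y hy
      apply Submodule.reflection_mem_subspace_eq_self
      rw [Submodule.mem_orthogonal_singleton_iff_inner_left]
      exact hn y (Submodule.subset_span hy)
    have hd3 : LinearMap.det (R3.toLinearEquiv : E3 →ₗ[ℝ] E3) = -1 := by
      have := Submodule.det_reflection (K := (ℝ ∙ n)ᗮ)
      rw [Submodule.orthogonal_orthogonal, finrank_span_singleton hn0, pow_one] at this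
      exact this
    refine ⟨R.trans R3, ?_, ?_, ?_⟩
    · have : ((R.trans R3).toLinearEquiv : E3 →ₗ[ℝ] E3) =
        (R3.toLinearEquiv : E3 →ₗ[ℝ] E3) ∘ₗ (R.toLinearEquiv : E3 →ₗ[ℝ] E3) := rfl
      rw [this, LinearMap.det_comp, hd3, h]; norm_num
    · simp [hRx, hfix]
    · simp [hRv, hfix]

/-- functions depending only on the invariants -/
def PInv {α : Type*} (F : Phase → α) : Prop :=
  ∀ z z' : Phase, ‖z.1‖ = ‖z'.1‖ → ‖z.2‖ = ‖z'.2‖ → inner ℝ z.1 z.2 = inner ℝ z'.1 z'.2 → F z = F z'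

lemma SphSym.inv {f : Phase → ℝ} (hf : SphSym f) : PInv f := by
  intro z z' h1 h2 h3
  obtain ⟨R, hR, hx, hv⟩ := exists_rot z.1 z.2 z'.1 z'.2 h1 h2 h3
  have := hf R hR z
  rw [← this, hx, hv]

lemma PInv.sph {f : Phase → ℝ} (hf : PInv f) : SphSym f := by
  intro R _ z
  apply hf <;> simp

lemma PInv.comp {α β : Type*} {F : Phase → α} (hF : PInv F) (G : α → β) : PInv (fun z => G (F z)) := by
  intro z z' h1 h2 h3
  simp only
  rw [hF z z' h1 h2 h3]

/-- canonical phase point -/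
def PP (p : ℝ × ℝ) (ℓ : ℝ) : Phase := (p.1 • e0, p.2 • e0 + (√ℓ / p.1) • e1)

def lam : Measure (ℝ × ℝ) :=
  ENNReal.ofReal (4 * π ^ 2) • ((volume.restrict (Ioi (0:ℝ))).prod volume)

instance : SFinite lam := by unfold lam; infer_instance

lemma PP_norm1 (p : ℝ × ℝ) (ℓ : ℝ) (hp : 0 < p.1) : ‖(PP p ℓ).1‖ = p.1 := by
  simp [PP, norm_smul, abs_of_pos hp]

lemma PP_norm2 (p : ℝ × ℝ) (ℓ : ℝ) (hl : 0 < ℓ) :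
    ‖(PP p ℓ).2‖ ^ 2 = p.2 ^ 2 + ℓ / p.1 ^ 2 := by
  rw [norm_sq_E3]
  simp [PP, div_pow, Real.sq_sqrt hl.le]

lemma PP_inner (p : ℝ × ℝ) (ℓ : ℝ) : inner ℝ (PP p ℓ).1 (PP p ℓ).2 = p.1 * p.2 := by
  simp [PP, PiLp.inner_apply, Fin.sum_univ_three, mul_comm]

lemma PP_ell (p : ℝ × ℝ) (ℓ : ℝ) (hp : 0 < p.1) (hl : 0 < ℓ) : ellOf (PP p ℓ) = ℓ := by
  unfold ellOf
  rw [PP_norm1 p ℓ hp, PP_norm2 p ℓ hl, PP_inner]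
  field_simp
  ring

lemma PP_meas : Measurable fun q : ℝ × (ℝ × ℝ) => PP q.2 q.1 := by
  unfold PP
  fun_prop

lemma PP_meas' (ℓ : ℝ) : Measurable fun p : (ℝ × ℝ) => PP p ℓ := by
  unfold PP
  fun_prop

lemma lint_lam (G : ℝ × ℝ → ℝ≥0∞) (hG : Measurable G) :
    ∫⁻ p, G p ∂lam = ENNReal.ofReal (4 * π ^ 2) * ∫⁻ r in Ioi (0:ℝ), ∫⁻ w : ℝ, G (r, w) := by
  unfold lam
  rw [lintegral_smul_measure, lintegral_prod _ hG.aemeasurable, smul_eq_mul]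

lemma lint_phase (F : Phase → ℝ≥0∞) (hF : Measurable F) (hi : PInv F) :
    ∫⁻ z, F z = ∫⁻ ℓ in Ioi (0:ℝ), ∫⁻ p, F (PP p ℓ) ∂lam := by
  let G : E3 → ℝ≥0∞ := fun x => ∫⁻ v, F (x, v)
  have hG : Measurable G := hF.lintegral_prod_right'
  have hGr : ∀ x, G x = G (‖x‖ • e0) := by
    intro x
    obtain ⟨R, hR, hx, -⟩ := exists_rot (‖x‖ • e0) 0 x 0 (by simp [norm_smul]) rfl (by simp)
    have := R.measurePreserving.lintegral_comp (f := fun v => F (x, v)) (by fun_prop)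
    simp only [G]
    rw [← this]
    refine lintegral_congr fun v => ?_
    apply hi
    · simp [norm_smul]
    · simp
    · simp only; nth_rw 1 [← hx]; rw [LinearIsometryEquiv.inner_map_map]
  have hG0 : ∀ r, 0 < r → G (r • e0) = ENNReal.ofReal (π / r ^ 2) * ∫⁻ w : ℝ, ∫⁻ ℓ in Ioi (0:ℝ), F (PP (r, w) ℓ) := by
    intro r hr
    have h1 : G (r • e0) = ∫⁻ v : E3, (fun w σ => F (r • e0, w • e0 + √σ • e1)) (v 0) (v 1 ^ 2 + v 2 ^ 2) := by
      refine lintegral_congr fun v => ?_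
      apply hi
      · rfl
      · rw [← sq_eq_sq₀ (norm_nonneg _) (norm_nonneg _), norm_sq_E3, norm_sq_E3]
        simp [Real.sq_sqrt (show 0 ≤ v 1 ^ 2 + v 2 ^ 2 by positivity)]
      · simp [PiLp.inner_apply, Fin.sum_univ_three]
    rw [h1, lint_cyl (fun w σ => F (r • e0, w • e0 + √σ • e1))]
    · have h2 : ∀ w : ℝ, ∫⁻ σ in Ioi (0:ℝ), F (r • e0, w • e0 + √σ • e1) =
          ENNReal.ofReal (1 / r ^ 2) * ∫⁻ ℓ in Ioi (0:ℝ), F (PP (r, w) ℓ) := by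
        intro w
        have him : (fun ℓ : ℝ => ℓ / r ^ 2) '' Ioi 0 = Ioi 0 := by
          ext σ
          simp only [mem_image, mem_Ioi]
          constructor
          · rintro ⟨ρ, h, rfl⟩; positivity
          · intro h
            exact ⟨σ * r ^ 2, by positivity, by field_simp⟩
        conv_lhs => rw [← him]
        rw [lintegral_image_eq_lintegral_abs_deriv_mul (f' := fun _ => 1 / r ^ 2) measurableSet_Ioi]
        · rw [← lintegral_const_mul' _ _ ENNReal.ofReal_ne_top]
          refine setLIntegral_congr_fun measurableSet_Ioi ?_
          intro ℓ hl
          simp only [mem_Ioi] at hl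
          simp only [abs_of_pos (show 0 < 1 / r ^ 2 by positivity), PP]
          rw [Real.sqrt_div hl.le, Real.sqrt_sq hr.le]
        · intro x _
          exact ((hasDerivAt_id x).div_const (r ^ 2)).hasDerivWithinAt
        · intro x _ y _ h
          field_simp at h
          simpa using h
      simp_rw [h2]
      rw [lintegral_const_mul' _ _ ENNReal.ofReal_ne_top, ← mul_assoc, ← ENNReal.ofReal_mul pi_pos.le]
      congr 2; ring
    · have : Measurable fun p : ℝ × ℝ => ((r • e0, p.1 • e0 + √p.2 • e1) : Phase) := by fun_prop
      exact hF.comp this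
  rw [Measure.volume_eq_prod, lintegral_prod _ hF.aemeasurable]
  change ∫⁻ x, G x = _
  rw [lintegral_congr hGr]
  rw [lint_rad (fun r => G (r • e0)) (hG.comp (by fun_prop))]
  have hm1 : ∀ ℓ, Measurable fun p => F (PP p ℓ) := fun ℓ => hF.comp (PP_meas' ℓ)
  have hm2 : Measurable fun q : ℝ × (ℝ × ℝ) => F (PP q.2 q.1) := hF.comp PP_meas
  simp_rw [lint_lam _ (hm1 _)]
  rw [lintegral_const_mul' _ _ ENNReal.ofReal_ne_top, lintegral_lintegral_swap,
    ← lintegral_const_mul' _ _ ENNReal.ofReal_ne_top]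
  · refine setLIntegral_congr_fun measurableSet_Ioi ?_
    intro r hr
    simp only [mem_Ioi] at hr
    simp only
    rw [hG0 r hr, ← mul_assoc, ← ENNReal.ofReal_mul (by positivity), lintegral_lintegral_swap]
    · congr 2
      field_simp
    · have : Measurable fun q : ℝ × ℝ => ((q.2, (r, q.1)) : ℝ × (ℝ × ℝ)) := by fun_prop
      exact (hm2.comp this).aemeasurable
  · apply Measurable.aemeasurable
    apply Measurable.lintegral_prod_right (f := fun (q : ℝ × ℝ) (w : ℝ) => F (PP (q.2, w) q.1))
    have : Measurable fun q : (ℝ × ℝ) × ℝ => ((q.1.1, (q.1.2, q.2)) : ℝ × (ℝ × ℝ)) := by fun_prop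
    exact hm2.comp this


lemma radPoint_eq (r u ℓ : ℝ) : radPoint r u ℓ = PP (r, Real.sign u * √(r ^ 2 * u ^ 2 - ℓ) / r) ℓ := rfl

lemma lint_u (r ℓ : ℝ) (hr : 0 < r) (hl : 0 < ℓ) (k : ℝ → ℝ≥0∞) :
    ∫⁻ u in {u : ℝ | ℓ < r ^ 2 * u ^ 2}, ENNReal.ofReal (r * |u| / √(r ^ 2 * u ^ 2 - ℓ)) *
      k (Real.sign u * √(r ^ 2 * u ^ 2 - ℓ) / r) = ∫⁻ w, k w := by
  set T : ℝ → ℝ := fun u => Real.sign u * √(r ^ 2 * u ^ 2 - ℓ) / r with hT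
  set S : Set ℝ := {u : ℝ | ℓ < r ^ 2 * u ^ 2} with hS
  have hSm : MeasurableSet S := measurableSet_lt (by fun_prop) (by fun_prop)
  have hS0 : ∀ u ∈ S, u ≠ 0 := by
    rintro u hu rfl
    simp only [hS, mem_ofPred_eq] at hu; norm_num at hu; linarith
  have him : T '' S = {0}ᶜ := by
    ext w
    simp only [mem_image, mem_compl_iff, mem_singleton_iff]
    constructor
    · rintro ⟨u, hu, rfl⟩
      have h1 := hS0 u hu
      have h2 : 0 < √(r ^ 2 * u ^ 2 - ℓ) := Real.sqrt_pos.2 (by simpa [hS] using hu)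
      have h3 : Real.sign u ≠ 0 := by simpa [Real.sign_eq_zero_iff] using h1
      simp only [hT]
      positivity
    · intro hw
      have hp : 0 < √(w ^ 2 + ℓ / r ^ 2) := by positivity
      have hsq : √(w ^ 2 + ℓ / r ^ 2) ^ 2 = w ^ 2 + ℓ / r ^ 2 := Real.sq_sqrt (by positivity)
      rcases lt_or_gt_of_ne hw with h | h
      · refine ⟨-√(w ^ 2 + ℓ / r ^ 2), ?_, ?_⟩
        · simp only [hS, mem_ofPred_eq, neg_sq, hsq]
          field_simp; have : 0 < r ^ 2 * w ^ 2 := by positivity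
          linarith
        · simp only [hT, neg_sq, hsq]
          rw [Real.sign_of_neg (by linarith), show r ^ 2 * (w ^ 2 + ℓ / r ^ 2) - ℓ = (r * (-w)) ^ 2 by field_simp; ring,
            Real.sqrt_sq (by nlinarith)]
          field_simp
      · refine ⟨√(w ^ 2 + ℓ / r ^ 2), ?_, ?_⟩
        · simp only [hS, mem_ofPred_eq, hsq]
          field_simp; have : 0 < r ^ 2 * w ^ 2 := by positivity
          linarith
        · simp only [hT, hsq]
          rw [Real.sign_of_pos (by linarith), show r ^ 2 * (w ^ 2 + ℓ / r ^ 2) - ℓ = (r * w) ^ 2 by field_simp; ring,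
            Real.sqrt_sq (by positivity)]
          field_simp
  have h0 : ∫⁻ w, k w = ∫⁻ w in T '' S, k w := by
    rw [him, restrict_compl_singleton]
  rw [h0, lintegral_image_eq_lintegral_abs_deriv_mul
    (f' := fun u => Real.sign u * (r ^ 2 * (2 * u) / (2 * √(r ^ 2 * u ^ 2 - ℓ))) / r) hSm]
  · refine setLIntegral_congr_fun hSm ?_
    intro u hu
    have h1 := hS0 u hu
    have h2 : 0 < √(r ^ 2 * u ^ 2 - ℓ) := Real.sqrt_pos.2 (by simpa [hS] using hu)
    simp only
    congr 2
    have h3 : |Real.sign u| = 1 := by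
      rcases lt_or_gt_of_ne h1 with h | h
      · simp [Real.sign_of_neg h]
      · simp [Real.sign_of_pos h]
    rw [abs_div, abs_mul, h3, abs_div, abs_mul, abs_mul, abs_mul, abs_of_pos h2, abs_of_pos hr,
      abs_of_pos (by positivity : 0 < r ^ 2), abs_two]
    field_simp
  · intro u hu
    have h1 := hS0 u hu
    have hpos : 0 < r ^ 2 * u ^ 2 - ℓ := by simpa [hS] using hu
    have hd : HasDerivAt (fun u : ℝ => r ^ 2 * u ^ 2 - ℓ) (r ^ 2 * (2 * u)) u := by
      have := ((hasDerivAt_pow 2 u).const_mul (r ^ 2)).sub_const ℓ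
      simpa using this
    have hd2 := ((hd.sqrt hpos.ne').const_mul (Real.sign u)).div_const r
    refine (hd2.congr_of_eventuallyEq ?_).hasDerivWithinAt
    rcases lt_or_gt_of_ne h1 with h | h
    · filter_upwards [gt_mem_nhds h] with y hy
      simp only [hT, Real.sign_of_neg h, Real.sign_of_neg hy]
    · filter_upwards [lt_mem_nhds h] with y hy
      simp only [hT, Real.sign_of_pos h, Real.sign_of_pos hy]
  · intro u hu v hv h
    have hpu : 0 < r ^ 2 * u ^ 2 - ℓ := by simpa [hS] using hu
    have hpv : 0 < r ^ 2 * v ^ 2 - ℓ := by simpa [hS] using hv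
    have hsu := Real.sqrt_pos.2 hpu
    have hsv := Real.sqrt_pos.2 hpv
    have h' : Real.sign u * √(r ^ 2 * u ^ 2 - ℓ) = Real.sign v * √(r ^ 2 * v ^ 2 - ℓ) := by
      simp only [hT] at h
      field_simp at h; exact h
    rcases lt_or_gt_of_ne (hS0 u hu) with h1 | h1 <;> rcases lt_or_gt_of_ne (hS0 v hv) with h2 | h2 <;>
      simp only [Real.sign_of_neg, Real.sign_of_pos, h1, h2] at h'
    · have : r ^ 2 * u ^ 2 - ℓ = r ^ 2 * v ^ 2 - ℓ := (Real.sqrt_inj hpu.le hpv.le).1 (by linarith)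
      have h3 : u ^ 2 = v ^ 2 := by
        have : r ^ 2 * u ^ 2 = r ^ 2 * v ^ 2 := by linarith
        exact mul_left_cancel₀ (by positivity) this
      nlinarith [sq_eq_sq_iff_eq_or_eq_neg.1 h3]
    · linarith
    · linarith
    · have : r ^ 2 * u ^ 2 - ℓ = r ^ 2 * v ^ 2 - ℓ := (Real.sqrt_inj hpu.le hpv.le).1 (by linarith)
      have h3 : u ^ 2 = v ^ 2 := by
        have : r ^ 2 * u ^ 2 = r ^ 2 * v ^ 2 := by linarith
        exact mul_left_cancel₀ (by positivity) this
      rcases sq_eq_sq_iff_eq_or_eq_neg.1 h3 with h4 | h4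
      · exact h4
      · linarith

lemma measurable_sign' : Measurable Real.sign := by
  unfold Real.sign
  exact Measurable.ite measurableSet_Iio measurable_const
    (Measurable.ite measurableSet_Ioi measurable_const measurable_const)

lemma nuDens_meas : Measurable fun q : ℝ × (ℝ × ℝ) => nuDens q.1 q.2 := by
  unfold nuDens
  refine Measurable.ite ?_ (by fun_prop) measurable_const
  have h1 : MeasurableSet {q : ℝ × (ℝ × ℝ) | 0 < q.2.1} := measurableSet_lt (by fun_prop) (by fun_prop)
  have h2 : MeasurableSet {q : ℝ × (ℝ × ℝ) | q.1 < q.2.1 ^ 2 * q.2.2 ^ 2} :=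
    measurableSet_lt (by fun_prop) (by fun_prop)
  exact h1.inter h2

lemma radPoint_meas : Measurable fun q : ℝ × (ℝ × ℝ) => radPoint q.2.1 q.2.2 q.1 := by
  have := measurable_sign'
  unfold radPoint
  fun_prop

lemma muDist_eq (f : Phase → ℝ) (hf : Measurable f) (s ℓ : ℝ) (hl : 0 < ℓ) :
    muDist f s ℓ = lam {p | s < f (PP p ℓ)} := by
  have hm : MeasurableSet {p : ℝ × ℝ | s < f (PP p ℓ)} :=
    measurableSet_lt measurable_const (hf.comp (PP_meas' ℓ))
  have hm2 : MeasurableSet {p : ℝ × ℝ | s < f (radPoint p.1 p.2 ℓ)} :=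
    measurableSet_lt measurable_const (hf.comp (radPoint_meas.comp (by fun_prop : Measurable fun p : ℝ × ℝ => (ℓ, p))))
  have hnd : Measurable (nuDens ℓ) := nuDens_meas.comp (by fun_prop : Measurable fun p : ℝ × ℝ => (ℓ, p))
  unfold muDist nuMeas
  rw [withDensity_apply _ hm2, ← lintegral_indicator hm2, ← lintegral_indicator_one hm, lint_lam _ (measurable_one.indicator hm),
    Measure.volume_eq_prod, lintegral_prod _ (hnd.indicator hm2).aemeasurable,
    ← lintegral_const_mul' _ _ ENNReal.ofReal_ne_top, ← lintegral_indicator measurableSet_Ioi]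
  refine lintegral_congr fun r => ?_
  by_cases hr : 0 < r
  · rw [indicator_of_mem (by exact hr), ← lint_u r ℓ hr hl (fun w => {p : ℝ × ℝ | s < f (PP p ℓ)}.indicator 1 (r, w)), ← lintegral_const_mul' _ _ ENNReal.ofReal_ne_top,
      ← lintegral_indicator (measurableSet_lt (by fun_prop) (by fun_prop))]
    refine lintegral_congr fun u => ?_
    by_cases hu : ℓ < r ^ 2 * u ^ 2
    · rw [indicator_of_mem (s := {u : ℝ | ℓ < r ^ 2 * u ^ 2}) (by exact hu)]
      by_cases hs : s < f (radPoint r u ℓ)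
      · rw [indicator_of_mem (by exact hs), indicator_of_mem (by exact hs)]
        simp only [nuDens, hr, hu, and_self, if_true, Pi.one_apply, mul_one]
        rw [← ENNReal.ofReal_mul (by positivity)]
        congr 1; ring
      · rw [indicator_of_notMem (by exact hs), indicator_of_notMem (by exact hs)]
        simp
    · rw [indicator_of_notMem (s := {u : ℝ | ℓ < r ^ 2 * u ^ 2}) (by exact hu)]
      simp only [indicator, nuDens, hr, hu, and_false, if_false]
      simp
  · rw [indicator_of_notMem (by exact hr)]
    simp only [indicator, nuDens, hr, false_and, if_false]
    simp

lemma muDist_meas (f : Phase → ℝ) (hf : Measurable f) (s : ℝ) : Measurable (muDist f s) := by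
  have hm2 : MeasurableSet {q : ℝ × (ℝ × ℝ) | s < f (radPoint q.2.1 q.2.2 q.1)} :=
    measurableSet_lt measurable_const (hf.comp radPoint_meas)
  have : muDist f s = fun ℓ => ∫⁻ p, ({q : ℝ × (ℝ × ℝ) | s < f (radPoint q.2.1 q.2.2 q.1)}.indicator
      (fun q => nuDens q.1 q.2)) (ℓ, p) := by
    funext ℓ
    unfold muDist nuMeas
    have hm2 : MeasurableSet {p : ℝ × ℝ | s < f (radPoint p.1 p.2 ℓ)} :=
      measurableSet_lt measurable_const (hf.comp (radPoint_meas.comp (by fun_prop : Measurable fun p : ℝ × ℝ => (ℓ, p))))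
    rw [withDensity_apply _ hm2, ← lintegral_indicator hm2]
    rfl
  rw [this]
  exact (nuDens_meas.indicator hm2).lintegral_prod_right'

lemma muDist_anti (f : Phase → ℝ) (ℓ : ℝ) : Antitone fun s => muDist f s ℓ := by
  intro s t hst
  exact measure_mono fun p hp => lt_of_le_of_lt hst hp

/-- right continuity -/
lemma muDist_right (f : Phase → ℝ) (s ℓ : ℝ) (t : ℝ≥0∞) (h : t < muDist f s ℓ) :
    ∃ s' > s, t < muDist f s' ℓ := by
  have hU : {p : ℝ × ℝ | s < f (radPoint p.1 p.2 ℓ)} =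
      ⋃ n : ℕ, {p : ℝ × ℝ | s + 1 / ((n : ℝ) + 1) < f (radPoint p.1 p.2 ℓ)} := by
    ext p
    simp only [mem_ofPred_eq, mem_iUnion]
    constructor
    · intro hp
      obtain ⟨n, hn⟩ := exists_nat_one_div_lt (sub_pos.2 hp)
      exact ⟨n, by linarith⟩
    · rintro ⟨n, hn⟩
      have : (0:ℝ) < 1 / ((n : ℝ) + 1) := by positivity
      linarith
  have hmono : Monotone fun n : ℕ => {p : ℝ × ℝ | s + 1 / ((n : ℝ) + 1) < f (radPoint p.1 p.2 ℓ)} := by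
    intro n m hnm p hp
    have : (1:ℝ) / ((m : ℝ) + 1) ≤ 1 / ((n : ℝ) + 1) := one_div_le_one_div_of_le (by positivity) (by exact_mod_cast Nat.succ_le_succ hnm)
    simp only [mem_ofPred_eq] at hp ⊢
    linarith
  unfold muDist at h
  rw [hU, hmono.measure_iUnion, lt_iSup_iff] at h
  obtain ⟨n, hn⟩ := h
  exact ⟨_, by simp only [gt_iff_lt, lt_add_iff_pos_right]; positivity, hn⟩

lemma schwarz_eq_iSup (f : Phase → ℝ) (t ℓ : ℝ) :
    schwarz f t ℓ = ⨆ q : ℚ≥0, if ENNReal.ofReal t < muDist f (q : ℝ) ℓ then (q : ℝ) else 0 := by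
  have key : ∀ s, 0 ≤ s → ENNReal.ofReal t < muDist f s ℓ →
      ∃ q : ℚ≥0, s < (q : ℝ) ∧ ENNReal.ofReal t < muDist f (q : ℝ) ℓ := by
    intro s hs h
    obtain ⟨s', hs', h'⟩ := muDist_right f s ℓ _ h
    obtain ⟨q, hq1, hq2⟩ := exists_rat_btwn hs'
    have hq0 : (0:ℚ) ≤ q := by
      have : (0:ℝ) < q := lt_of_le_of_lt hs hq1
      exact_mod_cast this.le
    refine ⟨⟨q, hq0⟩, hq1, lt_of_lt_of_le h' (muDist_anti f ℓ ?_)⟩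
    exact hq2.le
  unfold schwarz
  split_ifs with h0
  · set A := {s : ℝ | 0 ≤ s ∧ ENNReal.ofReal t < muDist f s ℓ} with hA
    have h0A : (0:ℝ) ∈ A := ⟨le_rfl, h0⟩
    have hmem : ∀ q : ℚ≥0, (if ENNReal.ofReal t < muDist f (q : ℝ) ℓ then (q : ℝ) else 0) ∈ A := by
      intro q
      split_ifs with h
      · exact ⟨by positivity, h⟩
      · exact h0A
    by_cases hb : BddAbove A
    · have hb2 : BddAbove (range fun q : ℚ≥0 => if ENNReal.ofReal t < muDist f (q : ℝ) ℓ then (q : ℝ) else 0) := by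
        refine hb.mono ?_
        rintro _ ⟨q, rfl⟩
        exact hmem q
      apply le_antisymm
      · refine csSup_le ⟨0, h0A⟩ ?_
        rintro s ⟨hs, h⟩
        obtain ⟨q, hq, h'⟩ := key s hs h
        refine hq.le.trans ?_
        have := le_ciSup hb2 q
        simpa only [h', if_true] using this
      · exact ciSup_le fun q => le_csSup hb (hmem q)
    · rw [Real.sSup_of_not_bddAbove hb, Real.iSup_of_not_bddAbove]
      rintro ⟨B, hB⟩
      apply hb
      refine ⟨B, ?_⟩
      rintro s ⟨hs, h⟩
      obtain ⟨q, hq, h'⟩ := key s hs h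
      refine hq.le.trans ?_
      have := hB ⟨q, rfl⟩
      simpa only [h', if_true] using this
  · have : ∀ q : ℚ≥0, (if ENNReal.ofReal t < muDist f (q : ℝ) ℓ then (q : ℝ) else 0) = 0 := by
      intro q
      rw [if_neg]
      intro h
      exact h0 (h.trans_le (muDist_anti f ℓ (by positivity)))
    simp only [this, ciSup_const]

lemma schwarz_meas (f : Phase → ℝ) (hf : Measurable f) : Measurable fun q : ℝ × ℝ => schwarz f q.1 q.2 := by
  simp_rw [schwarz_eq_iSup]
  refine Measurable.iSup fun q => Measurable.ite ?_ measurable_const measurable_const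
  exact measurableSet_lt (by fun_prop) ((muDist_meas f hf _).comp measurable_snd)

lemma schwarz_nonneg (f : Phase → ℝ) (t ℓ : ℝ) : 0 ≤ schwarz f t ℓ := by
  unfold schwarz
  split_ifs
  · exact Real.sSup_nonneg fun s hs => hs.1
  · exact le_rfl

lemma lt_schwarz_iff (f : Phase → ℝ) (t ℓ s C : ℝ) (hs : 0 ≤ s) (hC : muDist f C ℓ = 0) :
    s < schwarz f t ℓ ↔ ENNReal.ofReal t < muDist f s ℓ := by
  have hb : BddAbove {s : ℝ | 0 ≤ s ∧ ENNReal.ofReal t < muDist f s ℓ} := by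
    refine ⟨C, ?_⟩
    rintro s ⟨_, h⟩
    by_contra hc
    push Not at hc
    have := h.trans_le (muDist_anti f ℓ hc.le)
    simp only [hC] at this
    exact not_lt_bot this
  unfold schwarz
  constructor
  · split_ifs with h0
    · intro h
      obtain ⟨s', ⟨_, h'⟩, hlt⟩ := exists_lt_of_lt_csSup (by exact ⟨0, le_rfl, h0⟩) h
      exact h'.trans_le (muDist_anti f ℓ hlt.le)
    · intro h; linarith
  · intro h
    rw [if_pos (h.trans_le (muDist_anti f ℓ hs))]
    obtain ⟨s', hs', h'⟩ := muDist_right f s ℓ _ h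
    exact lt_of_lt_of_le hs' (le_csSup hb ⟨hs.trans (le_of_lt hs'), h'⟩)


lemma lint_newton_inner (r ρ : ℝ) (hr : 0 < r) (hρ : 0 < ρ) :
    ∫⁻ w in Ioo (-ρ) ρ, ENNReal.ofReal (1 / √(r ^ 2 - 2 * r * w + ρ ^ 2)) =
      ENNReal.ofReal ((r + ρ - |r - ρ|) / r) := by
  have hab : |r - ρ| < r + ρ := abs_lt.2 ⟨by linarith, by linarith⟩
  have him : (fun q : ℝ => (r ^ 2 + ρ ^ 2 - q ^ 2) / (2 * r)) '' Ioo |r - ρ| (r + ρ) = Ioo (-ρ) ρ := by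
    ext w
    simp only [mem_image, mem_Ioo]
    constructor
    · rintro ⟨q, ⟨h1, h2⟩, rfl⟩
      have h0 := abs_nonneg (r - ρ)
      have h3 : (r - ρ) ^ 2 < q ^ 2 := by rw [← sq_abs]; exact pow_lt_pow_left₀ h1 h0 (by norm_num)
      have h4 : q ^ 2 < (r + ρ) ^ 2 := pow_lt_pow_left₀ h2 (h0.trans h1.le) (by norm_num)
      constructor
      · rw [lt_div_iff₀ (by positivity)]; nlinarith
      · rw [div_lt_iff₀ (by positivity)]; nlinarith
    · rintro ⟨h1, h2⟩
      have h3 : (r - ρ) ^ 2 < r ^ 2 + ρ ^ 2 - 2 * r * w := by nlinarith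
      have h4 : r ^ 2 + ρ ^ 2 - 2 * r * w < (r + ρ) ^ 2 := by nlinarith
      refine ⟨√(r ^ 2 + ρ ^ 2 - 2 * r * w), ⟨?_, ?_⟩, ?_⟩
      · apply Real.lt_sqrt_of_sq_lt; rwa [sq_abs]
      · rw [Real.sqrt_lt' (by positivity)]; exact h4
      · rw [Real.sq_sqrt (by nlinarith [sq_nonneg (r - ρ)])]; field_simp; ring
  rw [← him, lintegral_image_eq_lintegral_abs_deriv_mul (f' := fun q => -(2 * q) / (2 * r)) measurableSet_Ioo]
  · have : ∀ q ∈ Ioo |r - ρ| (r + ρ), ENNReal.ofReal |-(2 * q) / (2 * r)| *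
        ENNReal.ofReal (1 / √(r ^ 2 - 2 * r * ((r ^ 2 + ρ ^ 2 - q ^ 2) / (2 * r)) + ρ ^ 2)) = ENNReal.ofReal (1 / r) := by
      intro q hq
      have hq0 : 0 < q := lt_of_le_of_lt (abs_nonneg _) hq.1
      rw [← ENNReal.ofReal_mul (by positivity),
        show r ^ 2 - 2 * r * ((r ^ 2 + ρ ^ 2 - q ^ 2) / (2 * r)) + ρ ^ 2 = q ^ 2 by field_simp; ring,
        Real.sqrt_sq hq0.le, abs_div, abs_neg, abs_of_pos (by positivity : 0 < 2 * q), abs_of_pos (by positivity : 0 < 2 * r)]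
      congr 1
      field_simp
    rw [setLIntegral_congr_fun measurableSet_Ioo this]
    simp only [lintegral_const, Measure.restrict_apply MeasurableSet.univ, univ_inter, Real.volume_Ioo]
    rw [← ENNReal.ofReal_mul (by positivity)]
    congr 1; ring
  · intro q _
    have := (((hasDerivAt_pow 2 q).const_sub (r ^ 2 + ρ ^ 2)).div_const (2 * r)).hasDerivWithinAt (s := Ioo |r - ρ| (r + ρ))
    simpa using this
  · intro x hx y hy h
    have hx0 : 0 < x := lt_of_le_of_lt (abs_nonneg _) hx.1
    have hy0 : 0 < y := lt_of_le_of_lt (abs_nonneg _) hy.1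
    have : x ^ 2 = y ^ 2 := by
      simp only at h
      field_simp at h; linarith
    exact (sq_eq_sq₀ hx0.le hy0.le).1 this

structure Good (ρ : E3 → ℝ) : Prop where
  meas : Measurable ρ
  nonneg : ∀ x, 0 ≤ ρ x
  fin : ∫⁻ x, ENNReal.ofReal (ρ x) ≠ ⊤
  rad : ∀ x y, ‖x‖ = ‖y‖ → ρ x = ρ y
  sing : ∫⁻ x, ENNReal.ofReal (ρ x) * ENNReal.ofReal (1 / ‖x‖) ≠ ⊤

lemma newton {ρ : E3 → ℝ} (h : Good ρ) (x : E3) :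
    ∫⁻ y, ENNReal.ofReal (ρ y) * ENNReal.ofReal (1 / ‖x - y‖) =
      ∫⁻ y, ENNReal.ofReal (ρ y) * ENNReal.ofReal (1 / max ‖x‖ ‖y‖) := by
  have hm := h.meas
  rcases eq_or_ne x 0 with rfl | hx
  · simp
  have hr : 0 < ‖x‖ := norm_pos_iff.2 hx
  set r := ‖x‖ with hrdef
  obtain ⟨R, -, hR, -⟩ := exists_rot (r • e0) 0 x 0 (by simp [norm_smul, hrdef]) rfl (by simp)
  have hrot : ∫⁻ y, ENNReal.ofReal (ρ y) * ENNReal.ofReal (1 / ‖x - y‖) =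
      ∫⁻ y, ENNReal.ofReal (ρ y) * ENNReal.ofReal (1 / ‖r • e0 - y‖) := by
    rw [← R.measurePreserving.lintegral_comp (by fun_prop)]
    refine lintegral_congr fun y => ?_
    rw [h.rad (R y) y (by simp), ← hR, ← map_sub, R.norm_map]
  let k : ℝ → ℝ≥0∞ := fun t => ENNReal.ofReal (ρ (t • e0))
  have hk : Measurable k := by
    have : Measurable fun t : ℝ => ρ (t • e0) := hm.comp (by fun_prop)
    exact this.ennreal_ofReal
  have hρk : ∀ y, ENNReal.ofReal (ρ y) = k ‖y‖ := by
    intro y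
    simp only [k]
    rw [h.rad y (‖y‖ • e0) (by simp [norm_smul])]
  have hn : ∀ y : E3, ‖r • e0 - y‖ = √(r ^ 2 - 2 * r * (y 0) + ‖y‖ ^ 2) := by
    intro y
    rw [← Real.sqrt_sq (norm_nonneg (r • e0 - y)), norm_sq_E3 (r • e0 - y), norm_sq_E3 y]
    congr 1
    simp
    ring
  rw [hrot]
  simp_rw [hρk, hn]
  rw [lint_ax (fun w t => k t * ENNReal.ofReal (1 / √(r ^ 2 - 2 * r * w + t ^ 2)))
    (by
      refine Measurable.mul (hk.comp measurable_snd) ?_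
      fun_prop),
    lint_rad (fun t => k t * ENNReal.ofReal (1 / max r t)) (by fun_prop)]
  refine setLIntegral_congr_fun measurableSet_Ioi ?_
  intro t ht
  simp only [mem_Ioi] at ht
  simp only
  rw [lintegral_const_mul' _ _ (by simp [k]), lint_newton_inner r t hr ht]
  generalize k t = K
  rw [mul_left_comm, mul_left_comm _ K,
    ← ENNReal.ofReal_mul (by positivity : 0 ≤ 2 * π * t), ← ENNReal.ofReal_mul (by positivity : 0 ≤ 4 * π * t ^ 2)]
  congr 2
  rcases le_total r t with h1 | h1
  · rw [max_eq_right h1, abs_of_nonpos (by linarith)]; field_simp; ring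
  · rw [max_eq_left h1, abs_of_nonneg (by linarith)]; field_simp; ring

/-- enclosed mass -/
def encl (ρ : E3 → ℝ) (t : ℝ) : ℝ≥0∞ := ∫⁻ y, (Metric.ball (0:E3) t).indicator (fun y => ENNReal.ofReal (ρ y)) y

lemma encl_fin {ρ : E3 → ℝ} (h : Good ρ) (t : ℝ) : encl ρ t ≠ ⊤ := by
  refine ne_top_of_le_ne_top h.fin (lintegral_mono fun y => ?_)
  exact indicator_le_self _ _ _

lemma encl_mono (ρ : E3 → ℝ) : Monotone (encl ρ) := by
  intro s t hst
  refine lintegral_mono fun y => ?_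
  exact indicator_le_indicator_of_subset (Metric.ball_subset_ball hst) (fun _ => zero_le) y

lemma encl_meas (ρ : E3 → ℝ) : Measurable (encl ρ) := (encl_mono ρ).measurable

lemma lint_inv_sq (a : ℝ) (ha : 0 < a) :
    ∫⁻ t in Ioi a, ENNReal.ofReal (1 / t ^ 2) = ENNReal.ofReal (1 / a) := by
  have h1 : ∀ x ∈ Ioi a, HasDerivAt (fun t : ℝ => -t⁻¹) (1 / x ^ 2) x := by
    intro x hx
    have hx0 : x ≠ 0 := (ha.trans hx).ne'
    have := (hasDerivAt_inv hx0).fun_neg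
    simpa [neg_div] using this
  have h2 : Tendsto (fun t : ℝ => -t⁻¹) atTop (𝓝 0) := by
    simpa using (tendsto_inv_atTop_zero (𝕜 := ℝ)).neg
  have hc : ContinuousWithinAt (fun t : ℝ => -t⁻¹) (Ici a) a :=
    (continuousAt_inv₀ ha.ne').neg.continuousWithinAt
  have hi := integrableOn_Ioi_deriv_of_nonneg hc h1 (fun x hx => by positivity) h2
  have := integral_Ioi_of_hasDerivAt_of_tendsto hc h1 hi h2
  rw [← ofReal_integral_eq_lintegral_ofReal hi (ae_of_all _ fun x => by positivity), this]
  simp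

lemma lint_max {ρ : E3 → ℝ} (h : Good ρ) (x : E3) :
    ∫⁻ y, ENNReal.ofReal (ρ y) * ENNReal.ofReal (1 / max ‖x‖ ‖y‖) =
      ∫⁻ t in Ioi ‖x‖, encl ρ t * ENNReal.ofReal (1 / t ^ 2) := by
  have hm := h.meas
  have h0 : ∀ᵐ y : E3, ENNReal.ofReal (ρ y) * ENNReal.ofReal (1 / max ‖x‖ ‖y‖) =
      ∫⁻ t in Ioi ‖x‖, (Metric.ball (0:E3) t).indicator (fun y => ENNReal.ofReal (ρ y)) y * ENNReal.ofReal (1 / t ^ 2) := by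
    have : ∀ᵐ y : E3, y ≠ 0 := by
      simp [ae_iff]
    filter_upwards [this] with y hy
    have hpos : 0 < max ‖x‖ ‖y‖ := lt_max_of_lt_right (norm_pos_iff.2 hy)
    rw [← lint_inv_sq _ hpos, ← lintegral_const_mul' _ _ ENNReal.ofReal_ne_top, ← lintegral_indicator measurableSet_Ioi,
      ← lintegral_indicator measurableSet_Ioi]
    refine lintegral_congr fun t => ?_
    by_cases h1 : ‖x‖ < t
    · by_cases h2 : ‖y‖ < t
      · rw [indicator_of_mem (by simpa using ⟨h1, h2⟩), indicator_of_mem (by exact h1), indicator_of_mem (by simpa using h2)]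
      · rw [indicator_of_notMem (by simp only [mem_Ioi, max_lt_iff]; tauto), indicator_of_mem (by exact h1), indicator_of_notMem (by simpa using h2)]
        simp
    · rw [indicator_of_notMem (by simp only [mem_Ioi, max_lt_iff]; tauto), indicator_of_notMem (by exact h1)]
  rw [lintegral_congr_ae h0, lintegral_lintegral_swap]
  · refine lintegral_congr fun t => ?_
    rw [lintegral_mul_const' _ _ ENNReal.ofReal_ne_top, encl]
  · have hs : MeasurableSet {p : E3 × ℝ | ‖p.1‖ < p.2} := measurableSet_lt (by fun_prop) (by fun_prop)
    have : Measurable fun p : E3 × ℝ => {p : E3 × ℝ | ‖p.1‖ < p.2}.indicator (fun p => ENNReal.ofReal (ρ p.1)) p * ENNReal.ofReal (1 / p.2 ^ 2) := by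
      refine Measurable.mul (Measurable.indicator (by fun_prop) hs) (by fun_prop)
    convert this.aemeasurable using 2 with p
    simp [Function.uncurry, indicator]

def pot (ρ : E3 → ℝ) (x : E3) : ℝ := - ∫ y : E3, ρ y / (4 * π * ‖x - y‖)

/-- radial force -/
def force (ρ : E3 → ℝ) (t : ℝ) : ℝ := (encl ρ t).toReal / (4 * π * t ^ 2)

lemma force_nonneg (ρ : E3 → ℝ) (t : ℝ) : 0 ≤ force ρ t := by unfold force; positivity

lemma force_meas (ρ : E3 → ℝ) : Measurable (force ρ) := by
  have := (encl_meas ρ).ennreal_toReal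
  unfold force; fun_prop

lemma force_ofReal {ρ : E3 → ℝ} (h : Good ρ) (t : ℝ) (ht : 0 < t) :
    ENNReal.ofReal (force ρ t) = ENNReal.ofReal (1 / (4 * π)) * (encl ρ t * ENNReal.ofReal (1 / t ^ 2)) := by
  unfold force
  nth_rw 2 [← ENNReal.ofReal_toReal (encl_fin h t)]
  rw [← ENNReal.ofReal_mul (by positivity), ← ENNReal.ofReal_mul (by positivity)]
  congr 1
  field_simp

lemma lint_force {ρ : E3 → ℝ} (h : Good ρ) (x : E3) :
    ∫⁻ y, ENNReal.ofReal (ρ y / (4 * π * ‖x - y‖)) = ∫⁻ t in Ioi ‖x‖, ENNReal.ofReal (force ρ t) := by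
  have h1 : ∀ y, ENNReal.ofReal (ρ y / (4 * π * ‖x - y‖)) =
      ENNReal.ofReal (1 / (4 * π)) * (ENNReal.ofReal (ρ y) * ENNReal.ofReal (1 / ‖x - y‖)) := by
    intro y
    rw [← ENNReal.ofReal_mul (h.nonneg y), ← ENNReal.ofReal_mul (by positivity)]
    congr 1
    rw [div_mul_eq_div_div]; ring
  rw [lintegral_congr h1, lintegral_const_mul' _ _ ENNReal.ofReal_ne_top, newton h, lint_max h,
    ← lintegral_const_mul' _ _ ENNReal.ofReal_ne_top]
  refine setLIntegral_congr_fun measurableSet_Ioi ?_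
  intro t ht
  exact (force_ofReal h t (lt_of_le_of_lt (norm_nonneg x) ht)).symm

lemma lint_force_fin {ρ : E3 → ℝ} (h : Good ρ) : ∫⁻ t in Ioi (0:ℝ), ENNReal.ofReal (force ρ t) ≠ ⊤ := by
  have h1 := lint_force h 0
  rw [norm_zero] at h1
  rw [← h1]
  refine ne_top_of_le_ne_top h.sing (lintegral_mono fun y => ?_)
  rw [← ENNReal.ofReal_mul (h.nonneg y)]
  apply ENNReal.ofReal_le_ofReal
  rw [div_mul_eq_div_div, zero_sub, norm_neg, mul_one_div]
  gcongr
  apply div_le_self (h.nonneg y)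
  nlinarith [pi_gt_three]

lemma force_int {ρ : E3 → ℝ} (h : Good ρ) : IntegrableOn (force ρ) (Ioi 0) := by
  refine ⟨(force_meas ρ).aestronglyMeasurable, ?_⟩
  rw [hasFiniteIntegral_iff_ofReal (ae_of_all _ (force_nonneg ρ))]
  exact (lint_force_fin h).lt_top

lemma pot_eq {ρ : E3 → ℝ} (h : Good ρ) (x : E3) : pot ρ x = - ∫ t in Ioi ‖x‖, force ρ t := by
  have hm := h.meas
  unfold pot
  rw [integral_eq_lintegral_of_nonneg_ae, lint_force h, integral_eq_lintegral_of_nonneg_ae]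
  · exact ae_of_all _ (force_nonneg ρ)
  · exact (force_meas ρ).aestronglyMeasurable
  · exact ae_of_all _ fun y => div_nonneg (h.nonneg y) (by positivity)
  · apply Measurable.aestronglyMeasurable
    fun_prop

lemma encl_cont {ρ : E3 → ℝ} (h : Good ρ) : Continuous fun t => (encl ρ t).toReal := by
  have hm := h.meas
  have hint : Integrable ρ := by
    refine ⟨hm.aestronglyMeasurable, ?_⟩
    rw [hasFiniteIntegral_iff_ofReal (ae_of_all _ h.nonneg)]
    exact h.fin.lt_top
  have he : ∀ t, (encl ρ t).toReal = ∫ y, (Metric.ball (0:E3) t).indicator ρ y := by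
    intro t
    rw [integral_eq_lintegral_of_nonneg_ae]
    · congr 1
      unfold encl
      refine lintegral_congr fun y => ?_
      by_cases hy : y ∈ Metric.ball (0:E3) t <;> simp [indicator, hy]
    · exact ae_of_all _ fun y => indicator_nonneg (fun y _ => h.nonneg y) y
    · exact (hm.indicator measurableSet_ball).aestronglyMeasurable
  simp_rw [he]
  rw [continuous_iff_continuousAt]
  intro t0
  rcases eq_or_ne t0 0 with h0 | h0
  all_goals
    apply continuousAt_of_dominated (bound := ρ)
    · exact Eventually.of_forall fun t => (hm.indicator measurableSet_ball).aestronglyMeasurable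
    · refine Eventually.of_forall fun t => ae_of_all _ fun y => ?_
      rw [Real.norm_of_nonneg (indicator_nonneg (fun y _ => h.nonneg y) y)]
      exact indicator_le_self' (fun y _ => h.nonneg y) y
    · exact hint
    · have : ∀ᵐ y : E3, ‖y‖ ≠ t0 := by
        first
        | subst h0; simp [ae_iff]
        | (have := Measure.addHaar_sphere_of_ne_zero (volume : Measure E3) (0:E3) h0
           rw [ae_iff]; convert this using 2; ext y; simp)
      filter_upwards [this] with y hy
      rcases lt_or_gt_of_ne hy with h1 | h1
      · refine (continuousAt_const (y := ρ y)).congr ?_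
        filter_upwards [lt_mem_nhds h1] with t ht
        simp [indicator, ht]
      · refine (continuousAt_const (y := (0:ℝ))).congr ?_
        filter_upwards [gt_mem_nhds h1] with t ht
        simp [indicator, ht.le]

lemma pot_grad {ρ : E3 → ℝ} (h : Good ρ) (x : E3) (hx : x ≠ 0) :
    HasGradientAt (pot ρ) ((force ρ ‖x‖ / ‖x‖) • x) x := by
  have hr : 0 < ‖x‖ := norm_pos_iff.2 hx
  set r := ‖x‖ with hrdef
  have hfi := force_int h
  have hG : HasDerivAt (fun s => - ∫ t in Ioi s, force ρ t) (force ρ r) r := by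
    have hcont : ContinuousAt (force ρ) r := by
      unfold force
      exact (encl_cont h).continuousAt.div (by fun_prop) (by positivity)
    have h1 : HasDerivAt (fun s => ∫ t in (r/2)..s, force ρ t) (force ρ r) r := by
      apply intervalIntegral.integral_hasDerivAt_right
      · rw [intervalIntegrable_iff_integrableOn_Ioc_of_le (by linarith)]
        exact hfi.mono_set fun t ht => lt_trans (by positivity) ht.1
      · exact (force_meas ρ).stronglyMeasurable.stronglyMeasurableAtFilter
      · exact hcont
    have h2 := h1.add_const (- ∫ t in Ioi (r/2), force ρ t)
    refine h2.congr_of_eventuallyEq ?_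
    filter_upwards [lt_mem_nhds (show r / 2 < r by linarith)] with s hs
    have hU : Ioi (r/2) = Ioc (r/2) s ∪ Ioi s := (Ioc_union_Ioi_eq_Ioi hs.le).symm
    rw [intervalIntegral.integral_of_le hs.le, hU, setIntegral_union]
    · ring
    · rw [Set.disjoint_left]; intro a ha hb; exact absurd ha.2 (not_le.2 hb)
    · exact measurableSet_Ioi
    · exact hfi.mono_set fun t ht => lt_trans (by positivity) ht.1
    · exact hfi.mono_set fun t ht => lt_trans (lt_trans (by positivity) hs) ht
  have hN : HasFDerivAt (fun y : E3 => ‖y‖) ((1 / (2 * √(‖x‖ ^ 2))) • (2 • innerSL ℝ x)) x := by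
    have := (hasStrictFDerivAt_norm_sq x).hasFDerivAt.sqrt (by positivity)
    refine this.congr_of_eventuallyEq (Eventually.of_forall fun y => ?_)
    simp [Real.sqrt_sq (norm_nonneg y)]
  have hcomp := HasDerivAt.comp_hasFDerivAt x (by rw [← hrdef]; exact hG) hN
  rw [hasGradientAt_iff_hasFDerivAt]
  have hp : pot ρ = (fun s => - ∫ t in Ioi s, force ρ t) ∘ fun y : E3 => ‖y‖ := by
    funext y; exact pot_eq h y
  rw [hp]
  have he : (InnerProductSpace.toDual ℝ E3) ((force ρ r / r) • x) =
      force ρ r • ((1 / (2 * √(‖x‖ ^ 2))) • (2 • innerSL ℝ x)) := by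
    ext y
    rw [InnerProductSpace.toDual_apply_apply, inner_smul_left, Real.sqrt_sq (norm_nonneg x), ← hrdef]
    simp
    field_simp
  rw [he]; exact hcomp


lemma Good.int {ρ : E3 → ℝ} (h : Good ρ) : Integrable ρ := by
  refine ⟨h.meas.aestronglyMeasurable, ?_⟩
  rw [hasFiniteIntegral_iff_ofReal (ae_of_all _ h.nonneg)]
  exact h.fin.lt_top

lemma pot_nonpos {ρ : E3 → ℝ} (h : Good ρ) (x : E3) : pot ρ x ≤ 0 := by
  unfold pot
  have : 0 ≤ ∫ y : E3, ρ y / (4 * π * ‖x - y‖) :=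
    integral_nonneg fun y => div_nonneg (h.nonneg y) (by positivity)
  linarith

lemma pot_meas {ρ : E3 → ℝ} (h : Good ρ) : Measurable (pot ρ) := by
  have hm := h.meas
  have : Measurable (fun p : E3 × E3 => ρ p.2 / (4 * π * ‖p.1 - p.2‖)) := by fun_prop
  exact (this.stronglyMeasurable.integral_prod_right).measurable.neg

lemma pot_rad {ρ : E3 → ℝ} (h : Good ρ) (x y : E3) (hxy : ‖x‖ = ‖y‖) : pot ρ x = pot ρ y := by
  rw [pot_eq h, pot_eq h, hxy]

lemma pot_lint {ρ : E3 → ℝ} (h : Good ρ) (x : E3) :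
    ENNReal.ofReal (- pot ρ x) = ∫⁻ t in Ioi ‖x‖, ENNReal.ofReal (force ρ t) := by
  rw [pot_eq h, neg_neg, ofReal_integral_eq_lintegral_ofReal]
  · exact (force_int h).mono_set (Ioi_subset_Ioi (norm_nonneg x))
  · exact ae_of_all _ (force_nonneg ρ)

lemma pot_lower {ρ : E3 → ℝ} (h : Good ρ) : ∃ C, 0 ≤ C ∧ ∀ x, -C ≤ pot ρ x := by
  refine ⟨∫ t in Ioi (0:ℝ), force ρ t, integral_nonneg (force_nonneg ρ), fun x => ?_⟩
  rw [pot_eq h]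
  apply neg_le_neg
  exact setIntegral_mono_set (force_int h) (ae_of_all _ (force_nonneg ρ))
    (Ioi_subset_Ioi (norm_nonneg x)).eventuallyLE

lemma pot_lint2 {ρ : E3 → ℝ} (h : Good ρ) (x : E3) :
    ENNReal.ofReal (- pot ρ x) = ENNReal.ofReal (1 / (4 * π)) *
      ∫⁻ t in Ioi ‖x‖, (encl ρ t * ENNReal.ofReal (1 / t ^ 2)) := by
  rw [pot_lint h, ← lintegral_const_mul' _ _ ENNReal.ofReal_ne_top]
  refine setLIntegral_congr_fun measurableSet_Ioi ?_
  intro t ht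
  exact force_ofReal h t (lt_of_le_of_lt (norm_nonneg x) ht)

lemma pot_ge {ρ : E3 → ℝ} (h : Good ρ) : ∃ M, 0 ≤ M ∧ ∀ x, x ≠ 0 → - pot ρ x ≤ M / ‖x‖ := by
  set M := ∫⁻ x, ENNReal.ofReal (ρ x)
  refine ⟨M.toReal, ENNReal.toReal_nonneg, fun x hx => ?_⟩
  have hr : 0 < ‖x‖ := norm_pos_iff.2 hx
  have h1 : ENNReal.ofReal (- pot ρ x) ≤ ENNReal.ofReal (M.toReal / ‖x‖) := by
    rw [pot_lint2 h]
    calc _ ≤ 1 * ∫⁻ t in Ioi ‖x‖, (M * ENNReal.ofReal (1 / t ^ 2)) := by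
          gcongr with t
          · rw [ENNReal.ofReal_le_one, div_le_one (by positivity)]
            nlinarith [pi_gt_three]
          · exact lintegral_mono fun y => indicator_le_self _ _ _
      _ = _ := by
          rw [one_mul, lintegral_const_mul' _ _ h.fin, lint_inv_sq _ hr, div_eq_mul_one_div M.toReal,
            ENNReal.ofReal_mul ENNReal.toReal_nonneg, ENNReal.ofReal_toReal h.fin]
  exact (ENNReal.ofReal_le_ofReal_iff (by positivity)).1 h1

lemma pot_le {ρ : E3 → ℝ} (h : Good ρ) (R : ℝ) (x : E3) (hR : R ≤ ‖x‖) (hx : x ≠ 0) :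
    pot ρ x ≤ - ((encl ρ R).toReal / (4 * π) / ‖x‖) := by
  have hr : 0 < ‖x‖ := norm_pos_iff.2 hx
  have h1 : ENNReal.ofReal ((encl ρ R).toReal / (4 * π) / ‖x‖) ≤ ENNReal.ofReal (- pot ρ x) := by
    rw [pot_lint2 h]
    calc _ = ENNReal.ofReal (1 / (4 * π)) * ∫⁻ t in Ioi ‖x‖, (encl ρ R * ENNReal.ofReal (1 / t ^ 2)) := by
          rw [lintegral_const_mul' _ _ (encl_fin h R), lint_inv_sq _ hr]
          nth_rw 2 [← ENNReal.ofReal_toReal (encl_fin h R)]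
          rw [← ENNReal.ofReal_mul (by positivity), ← ENNReal.ofReal_mul (by positivity)]
          congr 1; ring
      _ ≤ _ := by
          gcongr 1
          refine setLIntegral_mono_ae' measurableSet_Ioi (ae_of_all _ fun t ht => ?_)
          gcongr
          exact encl_mono ρ (hR.trans (le_of_lt ht))
  have := (ENNReal.ofReal_le_ofReal_iff (by have := pot_nonpos h x; linarith)).1 h1
  linarith

lemma lint_cross {ρ σ : E3 → ℝ} (h : Good ρ) (h' : Good σ) :
    ∫⁻ x, ENNReal.ofReal (σ x) * ENNReal.ofReal (- pot ρ x) =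
      ∫⁻ x : E3, ENNReal.ofReal (force ρ ‖x‖ * force σ ‖x‖) := by
  have hm := h.meas
  have hm' := h'.meas
  have hfm := force_meas ρ
  have hfm' := force_meas σ
  have h0 : ∀ x : E3, ENNReal.ofReal (σ x) * ENNReal.ofReal (- pot ρ x) =
      ∫⁻ t in Ioi (0:ℝ), (Metric.ball (0:E3) t).indicator (fun y => ENNReal.ofReal (σ y)) x * ENNReal.ofReal (force ρ t) := by
    intro x
    rw [pot_lint h, ← lintegral_const_mul' _ _ ENNReal.ofReal_ne_top, ← lintegral_indicator measurableSet_Ioi,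
      ← lintegral_indicator measurableSet_Ioi]
    refine lintegral_congr fun t => ?_
    by_cases h1 : ‖x‖ < t
    · rw [indicator_of_mem (by exact h1), indicator_of_mem (by exact lt_of_le_of_lt (norm_nonneg x) h1), indicator_of_mem (by simpa using h1)]
    · rw [indicator_of_notMem (by exact h1)]
      by_cases h2 : 0 < t
      · rw [indicator_of_mem (by exact h2), indicator_of_notMem (by simpa using h1)]
        simp
      · rw [indicator_of_notMem (by exact h2)]
  rw [lintegral_congr h0, lintegral_lintegral_swap]
  · rw [lint_rad (fun t => ENNReal.ofReal (force ρ t * force σ t)) (by fun_prop)]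
    refine setLIntegral_congr_fun measurableSet_Ioi ?_
    intro t ht
    have ht : 0 < t := ht
    simp only
    rw [lintegral_mul_const' _ _ ENNReal.ofReal_ne_top]
    change encl σ t * _ = _
    rw [← ENNReal.ofReal_toReal (encl_fin h' t), ← ENNReal.ofReal_mul (by positivity), ← ENNReal.ofReal_mul (by positivity)]
    congr 1
    have : force σ t * (4 * π * t ^ 2) = (encl σ t).toReal := by
      unfold force; field_simp
    rw [← this]; ring
  · have hs : MeasurableSet {p : E3 × ℝ | ‖p.1‖ < p.2} := measurableSet_lt (by fun_prop) (by fun_prop)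
    have : Measurable fun p : E3 × ℝ => {p : E3 × ℝ | ‖p.1‖ < p.2}.indicator (fun p => ENNReal.ofReal (σ p.1)) p * ENNReal.ofReal (force ρ p.2) := by
      refine Measurable.mul (Measurable.indicator (by fun_prop) hs) (by fun_prop)
    convert this.aemeasurable using 2 with p
    simp [Function.uncurry, indicator]

lemma mul_pot_int {ρ σ : E3 → ℝ} (h : Good ρ) (h' : Good σ) : Integrable (fun x => σ x * pot ρ x) := by
  obtain ⟨C, hC, hp⟩ := pot_lower h
  refine h'.int.mul_bdd (c := C) (pot_meas h).aestronglyMeasurable (ae_of_all _ fun x => ?_)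
  rw [Real.norm_eq_abs, abs_of_nonpos (pot_nonpos h x)]
  linarith [hp x]

lemma ae_ne_zero : ∀ᵐ y : E3, y ≠ 0 := by simp [ae_iff]

lemma grad_inner {ρ σ : E3 → ℝ} (h : Good ρ) (h' : Good σ) :
    (fun x => (inner ℝ (gradient (pot ρ) x) (gradient (pot σ) x) : ℝ)) =ᵐ[volume]
      fun x => force ρ ‖x‖ * force σ ‖x‖ := by
  filter_upwards [ae_ne_zero] with x hx
  have hr : 0 < ‖x‖ := norm_pos_iff.2 hx
  rw [(pot_grad h x hx).gradient, (pot_grad h' x hx).gradient, inner_smul_left, inner_smul_right,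
    real_inner_self_eq_norm_sq]
  simp
  field_simp

lemma cross {ρ σ : E3 → ℝ} (h : Good ρ) (h' : Good σ) :
    Integrable (fun x => (inner ℝ (gradient (pot ρ) x) (gradient (pot σ) x) : ℝ)) ∧
    ∫ x, (inner ℝ (gradient (pot ρ) x) (gradient (pot σ) x) : ℝ) = - ∫ x, σ x * pot ρ x := by
  have hfm := force_meas ρ
  have hfm' := force_meas σ
  have hmi := (mul_pot_int h h').neg
  have hle : ∫⁻ x : E3, ENNReal.ofReal (force ρ ‖x‖ * force σ ‖x‖) = ∫⁻ x, ENNReal.ofReal (-(σ x * pot ρ x)) := by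
    rw [← lint_cross h h']
    refine lintegral_congr fun x => ?_
    rw [← ENNReal.ofReal_mul (h'.nonneg x)]
    congr 1; ring
  have hnn : ∀ x, 0 ≤ -(σ x * pot ρ x) := fun x => by nlinarith [h'.nonneg x, pot_nonpos h x, mul_nonneg (h'.nonneg x) (neg_nonneg.2 (pot_nonpos h x))]
  have hnf : ∀ x : E3, 0 ≤ force ρ ‖x‖ * force σ ‖x‖ := fun x => mul_nonneg (force_nonneg _ _) (force_nonneg _ _)
  constructor
  · refine Integrable.congr ?_ (grad_inner h h').symm
    refine ⟨by apply Measurable.aestronglyMeasurable; fun_prop, ?_⟩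
    rw [hasFiniteIntegral_iff_ofReal (ae_of_all _ hnf), hle,
      ← hasFiniteIntegral_iff_ofReal (ae_of_all _ hnn)]
    exact hmi.2
  · rw [integral_congr_ae (grad_inner h h'), ← integral_neg, integral_eq_lintegral_of_nonneg_ae (ae_of_all _ hnf) (by apply Measurable.aestronglyMeasurable; fun_prop), hle,
      integral_eq_lintegral_of_nonneg_ae (ae_of_all _ hnn) hmi.1]

/-- main identity on fields -/
lemma field_id {ρ σ : E3 → ℝ} (h : Good ρ) (h' : Good σ) :
    (∫ x, ‖gradient (pot ρ) x - gradient (pot σ) x‖ ^ 2) =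
      (∫ x, ‖gradient (pot ρ) x‖ ^ 2) + 2 * (∫ x, σ x * pot ρ x) + ∫ x, ‖gradient (pot σ) x‖ ^ 2 := by
  have h1 := (cross h h).1
  have h2 := (cross h h').1
  have h3 := (cross h' h').1
  have h4 := (cross h h').2
  simp only [real_inner_self_eq_norm_sq] at h1 h3
  simp_rw [norm_sub_sq_real]
  rw [integral_add (by exact h1.sub (h2.const_mul 2)) h3, integral_sub h1 (h2.const_mul 2), integral_const_mul, h4]
  ring

lemma field_self {ρ : E3 → ℝ} (h : Good ρ) :
    (∫ x, ‖gradient (pot ρ) x‖ ^ 2) = - ∫ x, ρ x * pot ρ x := by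
  rw [← (cross h h).2]; simp only [real_inner_self_eq_norm_sq]


lemma memErad.fin {g : Phase → ℝ} (h : memErad g) : ∫⁻ z, ENNReal.ofReal (g z) ≠ ⊤ := by
  have h1 : eLpNorm g 1 volume < ⊤ := lt_of_le_of_lt (by unfold eNormE; rw [add_assoc]; exact le_self_add) h.1.2.2
  rw [eLpNorm_one_eq_lintegral_enorm] at h1
  convert h1.ne using 3 with z
  rw [Real.enorm_of_nonneg (h.1.2.1 z)]

lemma memErad.kin {g : Phase → ℝ} (h : memErad g) :
    ∫⁻ z : Phase, ENNReal.ofReal (‖z.2‖ ^ 2) * ENNReal.ofReal (g z) ≠ ⊤ := by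
  have h1 : ∫⁻ z : Phase, (‖z.2‖₊ : ℝ≥0∞) ^ 2 * (‖g z‖₊ : ℝ≥0∞) < ⊤ :=
    lt_of_le_of_lt (by unfold eNormE; exact le_add_self) h.1.2.2
  convert h1.ne using 3 with z
  congr 1
  · rw [ENNReal.ofReal_pow (norm_nonneg _)]; congr 1; exact ofReal_norm _
  · rw [← Real.enorm_of_nonneg (h.1.2.1 z)]; rfl

lemma memErad.bdd {g : Phase → ℝ} (h : memErad g) : ∃ C, 0 ≤ C ∧ ∀ᵐ z, g z ≤ C := by
  have h1 : eLpNorm g ⊤ volume < ⊤ :=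
    lt_of_le_of_lt (by unfold eNormE; rw [add_assoc]; exact le_add_left le_self_add) h.1.2.2
  refine ⟨(eLpNorm g ⊤ volume).toReal, ENNReal.toReal_nonneg, ?_⟩
  rw [eLpNorm_exponent_top] at h1 ⊢
  filter_upwards [ae_le_eLpNormEssSup (f := g) (μ := volume)] with z hz
  rw [Real.enorm_of_nonneg (h.1.2.1 z)] at hz
  exact (ENNReal.ofReal_le_iff_le_toReal h1.ne).1 hz

lemma memErad_of {g : Phase → ℝ} (hm : Measurable g) (hn : ∀ z, 0 ≤ g z) (hs : SphSym g)
    (h1 : ∫⁻ z, ENNReal.ofReal (g z) ≠ ⊤) (C : ℝ) (h2 : ∀ᵐ z, g z ≤ C)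
    (h3 : ∫⁻ z : Phase, ENNReal.ofReal (‖z.2‖ ^ 2) * ENNReal.ofReal (g z) ≠ ⊤) : memErad g := by
  refine ⟨⟨hm, hn, ?_⟩, hs⟩
  unfold eNormE
  refine ENNReal.add_lt_top.2 ⟨ENNReal.add_lt_top.2 ⟨?_, ?_⟩, ?_⟩
  · rw [eLpNorm_one_eq_lintegral_enorm, lt_top_iff_ne_top]
    convert h1 using 3 with z
    rw [Real.enorm_of_nonneg (hn z)]
  · refine lt_of_le_of_lt (eLpNorm_le_of_ae_bound (C := C) ?_) ?_
    · filter_upwards [h2] with z hz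
      rwa [Real.norm_of_nonneg (hn z)]
    · simp
  · rw [lt_top_iff_ne_top]
    convert h3 using 3 with z
    congr 1
    · rw [ENNReal.ofReal_pow (norm_nonneg _)]; congr 1; exact (ofReal_norm _).symm
    · rw [← Real.enorm_of_nonneg (hn z)]; rfl

lemma lint_sing : ∫⁻ z : Phase, {z : Phase | ‖z.1‖ < 1 ∧ ‖z.2‖ < √(1 / ‖z.1‖)}.indicator
    (fun z => ENNReal.ofReal (1 / ‖z.1‖)) z ≠ ⊤ := by
  have hs : MeasurableSet {z : Phase | ‖z.1‖ < 1 ∧ ‖z.2‖ < √(1 / ‖z.1‖)} := by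
    have a1 : MeasurableSet {z : Phase | ‖z.1‖ < 1} := measurableSet_lt (by fun_prop) (by fun_prop)
    have a2 : MeasurableSet {z : Phase | ‖z.2‖ < √(1 / ‖z.1‖)} := measurableSet_lt (by fun_prop) (by fun_prop)
    exact a1.inter a2
  rw [Measure.volume_eq_prod, lintegral_prod _ (Measurable.aemeasurable (Measurable.indicator (by fun_prop) hs))]
  have h1 : ∀ x : E3, ∫⁻ v : E3, {z : Phase | ‖z.1‖ < 1 ∧ ‖z.2‖ < √(1 / ‖z.1‖)}.indicator
      (fun z => ENNReal.ofReal (1 / ‖z.1‖)) (x, v) =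
      (fun r : ℝ => (Iio (1:ℝ)).indicator (fun r => ENNReal.ofReal (1 / r * (√(1 / r) ^ 3 * (π * 4 / 3)))) r) ‖x‖ := by
    intro x
    simp only
    by_cases hx : ‖x‖ < 1
    · rw [indicator_of_mem (by exact hx)]
      have : ∀ v : E3, {z : Phase | ‖z.1‖ < 1 ∧ ‖z.2‖ < √(1 / ‖z.1‖)}.indicator
        (fun z => ENNReal.ofReal (1 / ‖z.1‖)) (x, v) = (Metric.ball (0:E3) (√(1 / ‖x‖))).indicator (fun _ => ENNReal.ofReal (1 / ‖x‖)) v := by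
        intro v
        by_cases hv : ‖v‖ < √(1 / ‖x‖)
        · rw [indicator_of_mem (by exact ⟨hx, hv⟩), indicator_of_mem (by simpa using hv)]
        · rw [indicator_of_notMem (by exact fun h => hv h.2), indicator_of_notMem (by simpa using hv)]
      simp_rw [this]
      rw [lintegral_indicator measurableSet_ball, setLIntegral_const, EuclideanSpace.volume_ball_fin_three,
        ← ENNReal.ofReal_pow (by positivity), ← ENNReal.ofReal_mul (by positivity), ← ENNReal.ofReal_mul (by positivity)]
    · rw [indicator_of_notMem (by exact hx)]
      simp [indicator, hx]
  simp_rw [h1]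
  rw [lint_rad _ (Measurable.indicator (by fun_prop) measurableSet_Iio)]
  have h2 : ∫⁻ r in Ioi (0:ℝ), ENNReal.ofReal (4 * π * r ^ 2) * (Iio (1:ℝ)).indicator (fun r => ENNReal.ofReal (1 / r * (√(1 / r) ^ 3 * (π * 4 / 3)))) r
     = ∫⁻ r in Ioo (0:ℝ) 1, ENNReal.ofReal (4 * π * (π * 4 / 3) * r ^ (-(1/2) : ℝ)) := by
    rw [← lintegral_indicator measurableSet_Ioi, ← lintegral_indicator measurableSet_Ioo]
    refine lintegral_congr fun r => ?_
    by_cases h0 : 0 < r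
    · by_cases h1 : r < 1
      · rw [indicator_of_mem (by exact h0), indicator_of_mem (s := Ioo 0 1) (by exact ⟨h0, h1⟩), indicator_of_mem (by exact h1),
          ← ENNReal.ofReal_mul (by positivity), Real.rpow_neg h0.le, ← Real.sqrt_eq_rpow]
        congr 1
        rw [Real.sqrt_div zero_le_one, Real.sqrt_one]
        have hq : √r ^ 2 = r := Real.sq_sqrt h0.le
        have hq0 : 0 < √r := Real.sqrt_pos.2 h0
        generalize √r = q at *
        subst hq
        field_simp
      · rw [indicator_of_mem (by exact h0), indicator_of_notMem (s := Ioo 0 1) (by exact fun h => h1 h.2), indicator_of_notMem (by exact h1)]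
        simp
    · rw [indicator_of_notMem (by exact h0), indicator_of_notMem (by exact fun h => h0 h.1)]
  rw [h2]
  have h3 : IntegrableOn (fun r : ℝ => 4 * π * (π * 4 / 3) * r ^ (-(1/2) : ℝ)) (Ioo 0 1) := by
    have := (intervalIntegral.intervalIntegrable_rpow' (a := 0) (b := 1) (r := -(1/2)) (by norm_num))
    rw [intervalIntegrable_iff_integrableOn_Ioo_of_le zero_le_one] at this
    exact this.const_mul _
  have h4 := h3.2
  rw [hasFiniteIntegral_iff_ofReal] at h4
  · exact h4.ne
  · filter_upwards [ae_restrict_mem measurableSet_Ioo] with r hr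
    have := Real.rpow_nonneg hr.1.le (-(1/2))
    simp only [Pi.zero_apply]; positivity

lemma rho_le (g : Phase → ℝ) (hn : ∀ z, 0 ≤ g z) (hm : Measurable g) (x : E3) :
    ENNReal.ofReal (rhoF g x) ≤ ∫⁻ v, ENNReal.ofReal (g (x, v)) := by
  unfold rhoF
  rw [integral_eq_lintegral_of_nonneg_ae (ae_of_all _ fun v => hn _) (by apply Measurable.aestronglyMeasurable; fun_prop)]
  exact ENNReal.ofReal_toReal_le

lemma memErad.good {g : Phase → ℝ} (h : memErad g) : Good (rhoF g) := by
  have hm := h.1.1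
  have hn := h.1.2.1
  refine ⟨?_, ?_, ?_, ?_, ?_⟩
  · exact (hm.stronglyMeasurable.integral_prod_right').measurable
  · exact fun x => integral_nonneg fun v => hn _
  · refine ne_top_of_le_ne_top h.fin ?_
    rw [Measure.volume_eq_prod, lintegral_prod _ (by fun_prop)]
    exact lintegral_mono fun x => rho_le g hn hm x
  · intro x y hxy
    obtain ⟨R, hd, hR, -⟩ := exists_rot x 0 y 0 hxy rfl (by simp)
    unfold rhoF
    rw [← R.measurePreserving.integral_comp R.toHomeomorph.measurableEmbedding (fun v => g (y, v))]
    refine integral_congr_ae (ae_of_all _ fun v => ?_)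
    simp only
    rw [← hR]
    exact (h.2 R hd (x, v)).symm
  · obtain ⟨C, hC, hb⟩ := h.bdd
    have h1 : ∫⁻ z : Phase, ENNReal.ofReal (g z) * ENNReal.ofReal (1 / ‖z.1‖) ≤
        ∫⁻ z : Phase, ENNReal.ofReal (g z) + (ENNReal.ofReal (‖z.2‖ ^ 2) * ENNReal.ofReal (g z) +
          ENNReal.ofReal C * {z : Phase | ‖z.1‖ < 1 ∧ ‖z.2‖ < √(1 / ‖z.1‖)}.indicator
    (fun z => ENNReal.ofReal (1 / ‖z.1‖)) z) := by
      refine lintegral_mono_ae ?_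
      filter_upwards [hb] with z hz
      by_cases hx : ‖z.1‖ < 1
      · by_cases hv : ‖z.2‖ < √(1 / ‖z.1‖)
        · rw [indicator_of_mem (by exact ⟨hx, hv⟩)]
          refine le_add_left (le_add_left ?_)
          gcongr
        · refine le_add_left (le_add_right ?_)
          rw [mul_comm]
          gcongr
          exact Real.sqrt_le_left (norm_nonneg _) |>.1 (not_lt.1 hv)
      · refine le_add_right ?_
        calc _ ≤ ENNReal.ofReal (g z) * 1 := by
              gcongr
              rw [ENNReal.ofReal_le_one, div_le_one (by linarith)]
              linarith
          _ = _ := mul_one _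
    have h2 : ∫⁻ z : Phase, ENNReal.ofReal (g z) * ENNReal.ofReal (1 / ‖z.1‖) ≠ ⊤ := by
      refine ne_top_of_le_ne_top ?_ h1
      rw [lintegral_add_left (by fun_prop), lintegral_add_left (by fun_prop), lintegral_const_mul' _ _ ENNReal.ofReal_ne_top]
      exact ENNReal.add_ne_top.2 ⟨h.fin, ENNReal.add_ne_top.2 ⟨h.kin, ENNReal.mul_ne_top ENNReal.ofReal_ne_top lint_sing⟩⟩
    refine ne_top_of_le_ne_top h2 ?_
    rw [Measure.volume_eq_prod, lintegral_prod _ (by fun_prop)]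
    refine lintegral_mono fun x => ?_
    simp only
    rw [lintegral_mul_const' _ _ ENNReal.ofReal_ne_top]
    gcongr
    exact rho_le g hn hm x

lemma phiF_pot (g : Phase → ℝ) : phiF g = pot (rhoF g) := rfl

lemma memErad.int {g : Phase → ℝ} (h : memErad g) : Integrable g := by
  refine ⟨h.1.1.aestronglyMeasurable, ?_⟩
  rw [hasFiniteIntegral_iff_ofReal (ae_of_all _ h.1.2.1)]
  exact h.fin.lt_top

lemma memErad.kint {g : Phase → ℝ} (h : memErad g) : Integrable (fun z : Phase => ‖z.2‖ ^ 2 * g z) := by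
  have hm := h.1.1
  refine ⟨by apply Measurable.aestronglyMeasurable; fun_prop, ?_⟩
  rw [hasFiniteIntegral_iff_ofReal (ae_of_all _ fun z => mul_nonneg (by positivity) (h.1.2.1 z))]
  convert h.kin.lt_top using 3 with z
  rw [ENNReal.ofReal_mul (by positivity)]

lemma phi_int {f g : Phase → ℝ} (hf : memErad f) (h : memErad g) : Integrable (fun z : Phase => g z * phiF f z.1) := by
  have hp := pot_meas hf.good
  obtain ⟨C, hC, hb⟩ := pot_lower hf.good
  refine h.int.mul_bdd (c := C) (hp.comp measurable_fst).aestronglyMeasurable (ae_of_all _ fun z => ?_)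
  rw [phiF_pot, Real.norm_eq_abs, abs_of_nonpos (pot_nonpos hf.good _)]
  linarith [hb z.1]

lemma microE_int {f g : Phase → ℝ} (hf : memErad f) (h : memErad g) : Integrable (fun z : Phase => microE f z * g z) := by
  have := (h.kint.const_mul (1/2)).add (phi_int hf h)
  refine this.congr (ae_of_all _ fun z => ?_)
  simp [microE]; ring

lemma microE_integral {f g : Phase → ℝ} (hf : memErad f) (h : memErad g) :
    ∫ z : Phase, microE f z * g z = kineticE g / 2 + ∫ x, rhoF g x * pot (rhoF f) x := by
  have h1 : ∀ z : Phase, microE f z * g z = (1/2) * (‖z.2‖ ^ 2 * g z) + g z * phiF f z.1 := by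
    intro z; simp [microE]; ring
  simp_rw [h1]
  rw [integral_add (h.kint.const_mul (1/2)) (phi_int hf h), integral_const_mul]
  have h2 : ∫ z : Phase, g z * phiF f z.1 = ∫ x, rhoF g x * pot (rhoF f) x := by
    have := phi_int hf h
    rw [Measure.volume_eq_prod] at this ⊢
    rw [integral_prod _ this]
    refine integral_congr_ae (ae_of_all _ fun x => ?_)
    simp only
    rw [integral_mul_const]; rfl
  rw [h2]; unfold kineticE; ring

lemma ham_id {f g : Phase → ℝ} (hf : memErad f) (h : memErad g) :
    Ham g + (∫ x : E3, ‖gradPhi f x - gradPhi g x‖ ^ 2) / 2 = (∫ z : Phase, microE f z * g z) + fieldSq f / 2 := by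
  rw [microE_integral hf h]
  unfold Ham fieldSq gradPhi
  simp only [phiF_pot]
  rw [field_id hf.good h.good]
  ring


structure EHyp {α : Type*} [MeasurableSpace α] (lm : Measure α) (E : α → ℝ) : Prop where
  meas : Measurable E
  fin : ∀ e < 0, lm {p | E p < e} ≠ ⊤
  inf : lm {p | E p < 0} = ⊤
  null : ∀ e < 0, lm {p | E p = e} = 0
  low : ∃ C, 0 ≤ C ∧ ∀ p, -C ≤ E p

lemma EHyp.left {α : Type*} [MeasurableSpace α] {lm : Measure α} {E : α → ℝ} (_h : EHyp lm E) (e : ℝ) (m : ℝ≥0∞)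
    (hm : ∀ e' < e, lm {p | E p < e'} ≤ m) : lm {p | E p < e} ≤ m := by
  have hU : {p | E p < e} = ⋃ n : ℕ, {p | E p < e - 1 / ((n:ℝ) + 1)} := by
    ext p
    simp only [mem_ofPred_eq, mem_iUnion]
    constructor
    · intro hp
      obtain ⟨n, hn⟩ := exists_nat_one_div_lt (sub_pos.2 hp)
      exact ⟨n, by linarith⟩
    · rintro ⟨n, hn⟩
      have : (0:ℝ) < 1 / ((n:ℝ) + 1) := by positivity
      linarith
  have hmon : Monotone fun n : ℕ => {p | E p < e - 1 / ((n:ℝ) + 1)} := by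
    intro a b hab p hp
    have : 1 / ((b:ℝ) + 1) ≤ 1 / ((a:ℝ) + 1) := one_div_le_one_div_of_le (by positivity) (by exact_mod_cast Nat.succ_le_succ hab)
    simp only [mem_ofPred_eq] at hp ⊢
    linarith
  rw [hU, hmon.measure_iUnion]
  refine iSup_le fun n => hm _ ?_
  have : (0:ℝ) < 1 / ((n:ℝ) + 1) := by positivity
  linarith

lemma EHyp.right {α : Type*} [MeasurableSpace α] {lm : Measure α} {E : α → ℝ} (h : EHyp lm E) (e : ℝ) (he : e < 0) (m : ℝ≥0∞)
    (hm : ∀ e', e < e' → e' < 0 → m ≤ lm {p | E p < e'}) : m ≤ lm {p | E p < e} := by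
  obtain ⟨N, hN⟩ := exists_nat_one_div_lt (neg_pos.2 he)
  have hlt : ∀ n : ℕ, 1 / (((N + n : ℕ):ℝ) + 1) ≤ 1 / ((N:ℝ) + 1) := fun n =>
    one_div_le_one_div_of_le (by positivity) (by push_cast; linarith [Nat.cast_nonneg (α := ℝ) n])
  have hpos : ∀ n : ℕ, 0 < 1 / (((N + n : ℕ):ℝ) + 1) := fun n => by positivity
  have hU : {p | E p ≤ e} = ⋂ n : ℕ, {p | E p < e + 1 / (((N + n : ℕ):ℝ) + 1)} := by
    ext p
    simp only [mem_ofPred_eq, mem_iInter]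
    constructor
    · intro hp n
      linarith [hpos n]
    · intro hn
      by_contra hp
      obtain ⟨n, hn'⟩ := exists_nat_one_div_lt (sub_pos.2 (not_le.1 hp))
      have h1 := hn n
      have : 1 / (((N + n : ℕ):ℝ) + 1) ≤ 1 / ((n:ℝ) + 1) :=
        one_div_le_one_div_of_le (by positivity) (by push_cast; linarith [Nat.cast_nonneg (α := ℝ) N])
      linarith
  have hanti : Antitone fun n : ℕ => {p | E p < e + 1 / (((N + n : ℕ):ℝ) + 1)} := by
    intro a b hab p hp
    have : 1 / (((N + b : ℕ):ℝ) + 1) ≤ 1 / (((N + a : ℕ):ℝ) + 1) := one_div_le_one_div_of_le (by positivity) (by exact_mod_cast Nat.succ_le_succ (Nat.add_le_add_left hab N))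
    simp only [mem_ofPred_eq] at hp ⊢
    linarith
  have h1 : m ≤ lm {p | E p ≤ e} := by
    rw [hU, hanti.measure_iInter (fun n => (measurableSet_lt h.meas measurable_const).nullMeasurableSet)
      ⟨0, h.fin _ (by linarith [hlt 0])⟩]
    refine le_iInf fun n => hm _ (by linarith [hpos n]) (by linarith [hlt n])
  refine h1.trans ?_
  have : {p | E p ≤ e} = {p | E p < e} ∪ {p | E p = e} := by
    ext p; simp [le_iff_lt_or_eq]
  rw [this]
  refine (measure_union_le _ _).trans ?_
  rw [h.null e he, add_zero]

lemma EHyp.em {α : Type*} [MeasurableSpace α] {lm : Measure α} {E : α → ℝ} (h : EHyp lm E) (m : ℝ≥0∞) (h0 : m ≠ 0) (ht : m ≠ ⊤) :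
    ∃ e < 0, lm {p | E p < e} = m ∧ ∀ e' < 0, (lm {p | E p < e'} < m ↔ e' < e) := by
  obtain ⟨C, hC, hlow⟩ := h.low
  have hmono : ∀ a b : ℝ, a ≤ b → lm {p | E p < a} ≤ lm {p | E p < b} := fun a b hab =>
    measure_mono fun p (hp : E p < a) => lt_of_lt_of_le hp hab
  have hne : ∃ e1 < 0, m ≤ lm {p | E p < e1} := by
    by_contra! hcon
    have := h.left 0 m (fun e' he' => (hcon e' he').le)
    rw [h.inf] at this
    exact ht (top_le_iff.1 this)
  obtain ⟨e1, he1, hme1⟩ := hne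
  let S : Set ℝ := {e | e < 0 ∧ lm {p | E p < e} < m}
  have hSb : ∀ e ∈ S, e ≤ e1 := by
    intro e he
    by_contra hcon
    exact absurd (hme1.trans (hmono e1 e (not_le.1 hcon).le)) (not_le.2 he.2)
  have hSn : (-C - 1) ∈ S := by
    refine ⟨by linarith, ?_⟩
    have : {p | E p < -C - 1} = ∅ := by
      ext p; simp only [mem_ofPred_eq, mem_empty_iff_false, iff_false, not_lt]; linarith [hlow p]
    rw [this, measure_empty]; exact pos_iff_ne_zero.2 h0
  have hbdd : BddAbove S := ⟨e1, hSb⟩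
  set e := sSup S with hedef
  have hele : e ≤ e1 := csSup_le ⟨_, hSn⟩ hSb
  have he0 : e < 0 := lt_of_le_of_lt hele he1
  have hlt : ∀ e' < e, lm {p | E p < e'} < m := by
    intro e' he'
    obtain ⟨b, hb, hb'⟩ := exists_lt_of_lt_csSup ⟨_, hSn⟩ he'
    exact lt_of_le_of_lt (hmono _ _ hb'.le) hb.2
  have heq : lm {p | E p < e} = m := by
    apply le_antisymm
    · exact h.left e m fun e' he' => (hlt e' he').le
    · refine h.right e he0 m fun e' he' he'0 => ?_
      by_contra hcon
      exact absurd (le_csSup hbdd (show e' ∈ S from ⟨he'0, not_le.1 hcon⟩)) (not_le.2 he')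
  refine ⟨e, he0, heq, fun e' he'0 => ⟨fun hh => ?_, hlt e'⟩⟩
  by_contra hcon
  exact absurd (heq ▸ hmono e e' (not_lt.1 hcon)) (not_le.2 hh)

lemma bathtub {α : Type*} [MeasurableSpace α] {lm : Measure α} {E : α → ℝ} (h : EHyp lm E) (S : Set α) (hS : MeasurableSet S)
    (e : ℝ) (he : e < 0) (heq : lm {p | E p < e} = lm S) :
    (∫⁻ p in S, ENNReal.ofReal (- E p) ∂lm ≤ ∫⁻ p in {p | E p < e}, ENNReal.ofReal (- E p) ∂lm) ∧
    (∫⁻ p in S, ENNReal.ofReal (- E p) ∂lm = ∫⁻ p in {p | E p < e}, ENNReal.ofReal (- E p) ∂lm → S =ᵐ[lm] {p | E p < e}) := by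
  have hEm := h.meas
  set T := {p | E p < e} with hT
  have hTm : MeasurableSet T := measurableSet_lt h.meas measurable_const
  have hTf : lm T ≠ ⊤ := h.fin e he
  have hI : lm (S ∩ T) ≠ ⊤ := ne_top_of_le_ne_top hTf (measure_mono inter_subset_right)
  have hd : lm (S \ T) = lm (T \ S) := by
    have h1 := measure_inter_add_sdiff (μ := lm) S hTm
    have h2 := measure_inter_add_sdiff (μ := lm) T hS
    rw [inter_comm T S, heq, ← h1] at h2
    exact ((ENNReal.add_right_inj hI).1 h2).symm
  have hdf : lm (T \ S) ≠ ⊤ := ne_top_of_le_ne_top hTf (measure_mono sdiff_subset)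
  set κ := ENNReal.ofReal (-e)
  set K : α → ℝ≥0∞ := fun p => ENNReal.ofReal (- E p)
  have hK : Measurable K := by simp only [K]; fun_prop
  have i1 : ∫⁻ p in S \ T, K p ∂lm ≤ κ * lm (T \ S) := by
    rw [← hd, ← setLIntegral_const]
    refine setLIntegral_mono' (hS.diff hTm) fun p hp => ?_
    refine ENNReal.ofReal_le_ofReal ?_
    have : ¬ E p < e := hp.2
    linarith
  have i2 : κ * lm (T \ S) ≤ ∫⁻ p in T \ S, K p ∂lm := by
    rw [← setLIntegral_const]
    refine setLIntegral_mono' (hTm.diff hS) fun p hp => ?_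
    refine ENNReal.ofReal_le_ofReal ?_
    have : E p < e := hp.1
    linarith
  have d1 := lintegral_inter_add_sdiff (μ := lm) K S hTm
  have d2 := lintegral_inter_add_sdiff (μ := lm) K T hS
  rw [inter_comm T S] at d2
  refine ⟨?_, fun hE => ?_⟩
  · rw [← d1, ← d2]
    exact add_le_add le_rfl (i1.trans i2)
  · obtain ⟨C, hC, hlow⟩ := h.low
    have hfin : ∫⁻ p in T, K p ∂lm ≠ ⊤ := by
      refine ne_top_of_le_ne_top (ENNReal.mul_ne_top (ENNReal.ofReal_ne_top (r := C)) hTf) ?_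
      rw [← setLIntegral_const]
      exact lintegral_mono fun p => ENNReal.ofReal_le_ofReal (by linarith [hlow p])
    have hfi : ∫⁻ p in S ∩ T, K p ∂lm ≠ ⊤ := ne_top_of_le_ne_top hfin (lintegral_mono_set inter_subset_right)
    rw [← d1, ← d2, ENNReal.add_right_inj hfi] at hE
    have i3 : ∫⁻ p in T \ S, K p ∂lm ≤ ∫⁻ p in T \ S, κ ∂lm := by
      rw [← hE, setLIntegral_const]; exact i1
    have hz : lm (T \ S) = 0 := by
      have := ae_eq_of_ae_le_of_lintegral_le (μ := lm.restrict (T \ S)) (f := fun _ => κ) (g := K) ?_ ?_ hK.aemeasurable i3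
      · rw [Filter.EventuallyEq, ae_restrict_iff' (hTm.diff hS), ae_iff] at this
        refine measure_mono_null ?_ this
        intro p hp hh
        have h1 : E p < e := hp.1
        have h2 := hh hp
        have h3 : κ < K p := (ENNReal.ofReal_lt_ofReal_iff (by linarith)).2 (by linarith)
        exact h3.ne h2
      · filter_upwards [ae_restrict_mem (hTm.diff hS)] with p hp
        refine ENNReal.ofReal_le_ofReal ?_
        have : E p < e := hp.1
        linarith
      · rw [setLIntegral_const]; exact ENNReal.mul_ne_top ENNReal.ofReal_ne_top hdf
    rw [ae_eq_set]
    exact ⟨hd.trans hz, hz⟩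

lemma layer_eq {α : Type*} [MeasurableSpace α] {lm : Measure α} {F : α → ℝ} (hF : Measurable F) (hn : ∀ p, 0 ≤ F p)
    {K : α → ℝ≥0∞} (hK : Measurable K) :
    ∫⁻ p, K p * ENNReal.ofReal (F p) ∂lm = ∫⁻ s in Ioi (0:ℝ), ∫⁻ p in {p | s < F p}, K p ∂lm := by
  have h1 := lintegral_eq_lintegral_meas_lt (lm.withDensity K) (f := F) (ae_of_all _ hn) hF.aemeasurable
  rw [lintegral_withDensity_eq_lintegral_mul _ hK hF.ennreal_ofReal] at h1
  simp only [Pi.mul_apply] at h1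
  rw [h1]
  refine lintegral_congr fun s => ?_
  rw [withDensity_apply _ (measurableSet_lt measurable_const hF)]

lemma ae_eq_of_levels {α : Type*} [MeasurableSpace α] {lm : Measure α} {F G : α → ℝ} (hF : ∀ p, 0 ≤ F p) (hG : ∀ p, 0 ≤ G p)
    (h : ∀ᵐ s ∂(volume.restrict (Ioi (0:ℝ))), {p | s < F p} =ᵐ[lm] {p | s < G p}) : F =ᵐ[lm] G := by
  rw [ae_restrict_iff' measurableSet_Ioi] at h
  have hd := Measure.dense_of_ae h
  obtain ⟨D, hDs, hDc, hDd⟩ := hd.exists_countable_dense_subset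
  have h1 : ∀ᵐ p ∂lm, ∀ s ∈ D, 0 < s → (s < F p ↔ s < G p) := by
    rw [ae_ball_iff hDc]
    intro s hs
    by_cases h0 : 0 < s
    · filter_upwards [(hDs hs) h0] with p hp _
      exact Iff.of_eq hp
    · exact ae_of_all _ fun p hp => absurd hp h0
  filter_upwards [h1] with p hp
  rcases lt_trichotomy (F p) (G p) with h2 | h2 | h2
  · obtain ⟨s, hs, ha, hb⟩ := hDd.exists_between h2
    exact absurd ((hp s hs (lt_of_le_of_lt (hF p) ha)).2 hb) (not_lt.2 ha.le)
  · exact h2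
  · obtain ⟨s, hs, ha, hb⟩ := hDd.exists_between h2
    exact absurd ((hp s hs (lt_of_le_of_lt (hG p) ha)).1 hb) (not_lt.2 ha.le)

lemma fiber {α : Type*} [MeasurableSpace α] {lm : Measure α} {E : α → ℝ} (h : EHyp lm E) {F G : α → ℝ}
    (hF : Measurable F) (hG : Measurable G) (hFn : ∀ p, 0 ≤ F p) (hGn : ∀ p, 0 ≤ G p)
    (hfin : ∫⁻ p, ENNReal.ofReal (F p) ∂lm ≠ ⊤)
    (hrel : ∀ s > 0, ∀ p, s < G p ↔ E p < 0 ∧ lm {q | E q < E p} < lm {q | s < F q}) :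
    (∀ s > 0, lm {p | s < G p} = lm {p | s < F p}) ∧
    (∫⁻ p, ENNReal.ofReal (G p) ∂lm = ∫⁻ p, ENNReal.ofReal (F p) ∂lm) ∧
    (∫⁻ p, ENNReal.ofReal (- E p) * ENNReal.ofReal (F p) ∂lm ≤ ∫⁻ p, ENNReal.ofReal (- E p) * ENNReal.ofReal (G p) ∂lm) ∧
    (∫⁻ p, ENNReal.ofReal (- E p) * ENNReal.ofReal (F p) ∂lm = ∫⁻ p, ENNReal.ofReal (- E p) * ENNReal.ofReal (G p) ∂lm →
      F =ᵐ[lm] G) := by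
  have hEm := h.meas
  have hK : Measurable fun p => ENNReal.ofReal (- E p) := by fun_prop
  have hfs : ∀ s > 0, lm {p | s < F p} ≠ ⊤ := by
    intro s hs
    have := meas_ge_le_lintegral_div (μ := lm) hF.ennreal_ofReal.aemeasurable (ε := ENNReal.ofReal s)
      (by simpa using hs) ENNReal.ofReal_ne_top
    refine ne_top_of_le_ne_top (ENNReal.div_ne_top hfin (by simpa using hs)) (le_trans (measure_mono ?_) this)
    intro p hp
    exact ENNReal.ofReal_le_ofReal (le_of_lt hp)
  have hlev : ∀ s > 0, (lm {p | s < G p} = lm {p | s < F p}) ∧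
      (∫⁻ p in {p | s < F p}, ENNReal.ofReal (- E p) ∂lm ≤ ∫⁻ p in {p | s < G p}, ENNReal.ofReal (- E p) ∂lm) ∧
      (∫⁻ p in {p | s < F p}, ENNReal.ofReal (- E p) ∂lm = ∫⁻ p in {p | s < G p}, ENNReal.ofReal (- E p) ∂lm →
        {p | s < F p} =ᵐ[lm] {p | s < G p}) := by
    intro s hs
    have hS : MeasurableSet {p | s < F p} := measurableSet_lt measurable_const hF
    rcases eq_or_ne (lm {p | s < F p}) 0 with h0 | h0
    · have hGe : {p | s < G p} = ∅ := by
        ext p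
        simp only [mem_ofPred_eq, hrel s hs p, h0, not_lt_zero, and_false, mem_empty_iff_false]
      rw [hGe, h0, setLIntegral_measure_zero _ _ h0]
      simp only [measure_empty, Measure.restrict_empty, lintegral_zero_measure, le_refl, true_and, forall_const]
      exact ae_eq_empty.2 h0
    · obtain ⟨e, he, heq, hiff⟩ := h.em _ h0 (hfs s hs)
      have hGe : {p | s < G p} = {p | E p < e} := by
        ext p
        simp only [mem_ofPred_eq, hrel s hs p]
        constructor
        · rintro ⟨a, b⟩; exact (hiff _ a).1 b
        · intro a; exact ⟨a.trans he, (hiff _ (a.trans he)).2 a⟩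
      rw [hGe]
      exact ⟨heq, bathtub h _ hS e he heq⟩
  have hmass : ∫⁻ p, ENNReal.ofReal (G p) ∂lm = ∫⁻ p, ENNReal.ofReal (F p) ∂lm := by
    rw [lintegral_eq_lintegral_meas_lt lm (ae_of_all _ hFn) hF.aemeasurable,
      lintegral_eq_lintegral_meas_lt lm (ae_of_all _ hGn) hG.aemeasurable]
    exact setLIntegral_congr_fun measurableSet_Ioi fun s hs => (hlev s hs).1
  refine ⟨fun s hs => (hlev s hs).1, hmass, ?_, fun heq => ?_⟩
  · rw [layer_eq hF hFn hK, layer_eq hG hGn hK]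
    exact setLIntegral_mono' measurableSet_Ioi fun s hs => (hlev s hs).2.1
  · have hle : (fun s => ∫⁻ p in {p | s < F p}, ENNReal.ofReal (- E p) ∂lm) ≤ᵐ[volume.restrict (Ioi (0:ℝ))]
        (fun s => ∫⁻ p in {p | s < G p}, ENNReal.ofReal (- E p) ∂lm) := by
      filter_upwards [ae_restrict_mem measurableSet_Ioi] with s hs
      exact (hlev s hs).2.1
    have hanti : Antitone (fun s => ∫⁻ p in {p | s < G p}, ENNReal.ofReal (- E p) ∂lm) := by
      intro a b hab
      exact lintegral_mono_set fun p (hp : b < G p) => lt_of_le_of_lt hab hp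
    obtain ⟨C, hC, hlow⟩ := h.low
    have hfinK : ∫⁻ p, ENNReal.ofReal (- E p) * ENNReal.ofReal (F p) ∂lm ≠ ⊤ := by
      refine ne_top_of_le_ne_top (ENNReal.mul_ne_top (ENNReal.ofReal_ne_top (r := C)) hfin) ?_
      rw [← lintegral_const_mul' _ _ ENNReal.ofReal_ne_top]
      refine lintegral_mono fun p => ?_
      gcongr
      linarith [hlow p]
    rw [layer_eq hF hFn hK] at heq hfinK
    rw [layer_eq hG hGn hK] at heq
    have := ae_eq_of_ae_le_of_lintegral_le hle hfinK hanti.measurable.aemeasurable heq.symm.le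
    apply ae_eq_of_levels hFn hGn
    filter_upwards [this, ae_restrict_mem measurableSet_Ioi] with s hs h0
    exact (hlev s h0).2.2 hs


lemma lam_ae : ∀ᵐ p ∂lam, 0 < p.1 := by
  rw [ae_iff]
  have : {p : ℝ × ℝ | ¬ 0 < p.1} = Iic 0 ×ˢ univ := by ext p; simp
  rw [this]
  unfold lam
  rw [Measure.smul_apply, Measure.prod_prod, Measure.restrict_apply measurableSet_Iic]
  rw [inter_comm, Ioi_inter_Iic, Ioc_self]
  simp

/-- reduced energy -/
def EE (f : Phase → ℝ) (ℓ : ℝ) (p : ℝ × ℝ) : ℝ := p.2 ^ 2 / 2 + psiPot (phiRad f) ℓ p.1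

lemma EE_eq (f : Phase → ℝ) (ℓ : ℝ) (hl : 0 < ℓ) (p : ℝ × ℝ) : microE f (PP p ℓ) = EE f ℓ p := by
  unfold microE EE psiPot
  rw [PP_norm2 p ℓ hl]
  change _ + phiRad f p.1 = _
  rcases eq_or_ne p.1 0 with h | h
  · rw [h]; simp
  · field_simp; ring

lemma phiRad_meas {f : Phase → ℝ} (hf : memErad f) : Measurable (phiRad f) := by
  unfold phiRad
  rw [phiF_pot]
  exact (pot_meas hf.good).comp (by fun_prop)

lemma psi_meas {f : Phase → ℝ} (hf : memErad f) : Measurable fun q : ℝ × ℝ => psiPot (phiRad f) q.1 q.2 := by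
  have := phiRad_meas hf
  unfold psiPot
  fun_prop

lemma psi_meas' {f : Phase → ℝ} (hf : memErad f) (ℓ : ℝ) : Measurable fun r : ℝ => psiPot (phiRad f) ℓ r := by
  have := phiRad_meas hf
  unfold psiPot
  fun_prop

lemma EE_meas {f : Phase → ℝ} (hf : memErad f) (ℓ : ℝ) : Measurable (EE f ℓ) := by
  have := psi_meas' hf ℓ
  unfold EE
  fun_prop

lemma aPot_meas {f : Phase → ℝ} (hf : memErad f) : Measurable fun q : ℝ × ℝ => aPot (phiRad f) q.1 q.2 := by
  unfold aPot
  have h1 : Measurable fun z : (ℝ × ℝ) × ℝ => √(max (z.1.1 - psiPot (phiRad f) z.1.2 z.2) 0) := by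
    have := phiRad_meas hf
    unfold psiPot
    fun_prop
  exact (h1.stronglyMeasurable.integral_prod_right' (ν := volume.restrict (Ioi (0:ℝ)))).measurable.const_mul _

lemma lam_apply (S : Set (ℝ × ℝ)) (hS : MeasurableSet S) :
    lam S = ENNReal.ofReal (4 * π ^ 2) * ∫⁻ r in Ioi (0:ℝ), volume (Prod.mk r ⁻¹' S) := by
  unfold lam
  rw [Measure.smul_apply, Measure.prod_apply hS, smul_eq_mul]

lemma vol_sect (a : ℝ) : volume {w : ℝ | w ^ 2 / 2 < a} = ENNReal.ofReal (2 * √2 * √(max a 0)) := by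
  have : {w : ℝ | w ^ 2 / 2 < a} = Ioo (-√(2 * a)) (√(2 * a)) := by
    ext w
    simp only [mem_ofPred_eq, mem_Ioo]
    rw [← abs_lt, Real.lt_sqrt (abs_nonneg w), sq_abs]
    constructor <;> intro h <;> linarith
  rw [this, Real.volume_Ioo]
  congr 1
  rcases le_total 0 a with h | h
  · rw [max_eq_left h, Real.sqrt_mul (by norm_num)]; ring
  · rw [max_eq_right h, Real.sqrt_eq_zero_of_nonpos (by linarith)]; simp

lemma lam_EE {f : Phase → ℝ} (hf : memErad f) (ℓ e : ℝ) :
    lam {p | EE f ℓ p < e} = ENNReal.ofReal (8 * π ^ 2 * √2) *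
      ∫⁻ r in Ioi (0:ℝ), ENNReal.ofReal (√(max (e - psiPot (phiRad f) ℓ r) 0)) := by
  rw [lam_apply _ (measurableSet_lt (EE_meas hf ℓ) measurable_const)]
  have : ∀ r, volume (Prod.mk r ⁻¹' {p | EE f ℓ p < e}) =
      ENNReal.ofReal (2 * √2) * ENNReal.ofReal (√(max (e - psiPot (phiRad f) ℓ r) 0)) := by
    intro r
    rw [← ENNReal.ofReal_mul (by positivity), ← vol_sect]
    congr 1
    ext w
    simp only [mem_preimage, mem_ofPred_eq, EE]
    constructor <;> intro h <;> linarith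
  simp_rw [this]
  rw [lintegral_const_mul' _ _ ENNReal.ofReal_ne_top, ← mul_assoc, ← ENNReal.ofReal_mul (by positivity)]
  congr 2; ring

lemma norm_se0 (r : ℝ) (hr : 0 < r) : ‖r • e0‖ = r := by simp [norm_smul, abs_of_pos hr]

lemma se0_ne (r : ℝ) (hr : 0 < r) : r • e0 ≠ 0 := by
  intro h
  have := norm_se0 r hr
  rw [h, norm_zero] at this
  exact hr.ne this

lemma lam_EE_fin {f : Phase → ℝ} (hf : memErad f) (ℓ e : ℝ) (hl : 0 < ℓ) (he : e < 0) :
    ∫⁻ r in Ioi (0:ℝ), ENNReal.ofReal (√(max (e - psiPot (phiRad f) ℓ r) 0)) ≠ ⊤ := by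
  obtain ⟨C, hC, hlow⟩ := pot_lower hf.good
  obtain ⟨M, hM, hge⟩ := pot_ge hf.good
  have h1 : ∫⁻ r in Ioi (0:ℝ), ENNReal.ofReal (√(max (e - psiPot (phiRad f) ℓ r) 0)) ≤
      ∫⁻ r in Ioi (0:ℝ), (Iic (M / (-e))).indicator (fun _ => ENNReal.ofReal (√C)) r := by
    refine setLIntegral_mono' measurableSet_Ioi fun r hr => ?_
    have hr : 0 < r := hr
    have hpos : 0 ≤ ℓ / (2 * r ^ 2) := by positivity
    by_cases h : r ≤ M / (-e)
    · rw [indicator_of_mem (by exact h)]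
      apply ENNReal.ofReal_le_ofReal
      apply Real.sqrt_le_sqrt
      apply max_le _ hC
      have : -C ≤ phiRad f r := hlow _
      unfold psiPot
      linarith
    · rw [indicator_of_notMem (by exact h)]
      have h2 : -(phiRad f r) ≤ M / r := by
        have := hge (r • e0) (se0_ne r hr)
        rwa [norm_se0 r hr] at this
      have h3 : M / r ≤ -e := by
        rw [not_le, div_lt_iff₀ (by linarith)] at h
        rw [div_le_iff₀ hr]; linarith
      rw [max_eq_right (by unfold psiPot; linarith)]
      simp
  refine ne_top_of_le_ne_top ?_ h1
  rw [lintegral_indicator measurableSet_Iic, setLIntegral_const, Measure.restrict_apply measurableSet_Iic]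
  refine ENNReal.mul_ne_top ENNReal.ofReal_ne_top ?_
  rw [inter_comm, Ioi_inter_Iic, Real.volume_Ioc]
  exact ENNReal.ofReal_ne_top

lemma lam_aPot {f : Phase → ℝ} (hf : memErad f) (ℓ e : ℝ) (hl : 0 < ℓ) (he : e < 0) :
    ENNReal.ofReal (aPot (phiRad f) e ℓ) = lam {p | EE f ℓ p < e} := by
  have := psi_meas' hf ℓ
  rw [lam_EE hf, aPot, ENNReal.ofReal_mul (by positivity), integral_eq_lintegral_of_nonneg_ae,
    ENNReal.ofReal_toReal (lam_EE_fin hf ℓ e hl he)]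
  · exact ae_of_all _ fun r => Real.sqrt_nonneg _
  · apply Measurable.aestronglyMeasurable; fun_prop

lemma encl_pos {f : Phase → ℝ} (hf : memErad f) (hf0 : ¬ f =ᵐ[volume] (0 : Phase → ℝ)) :
    ∃ R : ℝ, 0 < (encl (rhoF f) R).toReal := by
  by_contra! hcon
  apply hf0
  have hm := hf.good.meas
  have hz : ∀ n : ℕ, ∀ᵐ y, (Metric.ball (0:E3) n).indicator (fun y => ENNReal.ofReal (rhoF f y)) y = 0 := by
    intro n
    have h1 : encl (rhoF f) n = 0 := by
      rcases (ENNReal.toReal_eq_zero_iff _).1 (le_antisymm (hcon n) ENNReal.toReal_nonneg) with h | h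
      · exact h
      · exact absurd h (encl_fin hf.good _)
    unfold encl at h1
    rw [lintegral_eq_zero_iff (Measurable.indicator (by fun_prop) measurableSet_ball)] at h1
    exact h1
  have hz2 : rhoF f =ᵐ[volume] 0 := by
    filter_upwards [ae_all_iff.2 hz] with y hy
    obtain ⟨n, hn⟩ := exists_nat_gt ‖y‖
    have := hy n
    rw [indicator_of_mem (by simpa using hn), ENNReal.ofReal_eq_zero] at this
    exact le_antisymm this (hf.good.nonneg y)
  have hi := hf.int
  rw [← integral_eq_zero_iff_of_nonneg hf.1.2.1 hi]
  rw [Measure.volume_eq_prod] at hi ⊢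
  rw [integral_prod _ hi]
  change ∫ x, rhoF f x = 0
  rw [integral_congr_ae hz2]; simp

lemma lam_EE_inf {f : Phase → ℝ} (hf : memErad f) (hf0 : ¬ f =ᵐ[volume] (0 : Phase → ℝ)) (ℓ : ℝ) (hl : 0 < ℓ) :
    lam {p | EE f ℓ p < 0} = ⊤ := by
  obtain ⟨R, hR⟩ := encl_pos hf hf0
  set c := (encl (rhoF f) R).toReal / (4 * π) with hc
  have hcpos : 0 < c := by positivity
  set R1 := max (max R 1) (ℓ / c) with hR1
  have hR1pos : 1 ≤ R1 := le_max_of_le_left (le_max_right _ _)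
  rw [lam_EE hf, ENNReal.mul_eq_top]
  left
  refine ⟨by simp; positivity, ?_⟩
  rw [eq_top_iff]
  have hb : ∀ r ∈ Ioi R1, ENNReal.ofReal (√(c / 2) * r⁻¹) ≤ ENNReal.ofReal (√(max (0 - psiPot (phiRad f) ℓ r) 0)) := by
    intro r hr
    have hr : R1 < r := hr
    have hr1 : 1 < r := lt_of_le_of_lt hR1pos hr
    have hr0 : 0 < r := by linarith
    have hrR : R ≤ r := ((le_max_left _ _).trans (le_max_left _ _)).trans hr.le
    have hrl : ℓ / c ≤ r := (le_max_right _ _).trans hr.le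
    rw [div_le_iff₀ hcpos] at hrl
    have h1 : phiRad f r ≤ -(c / r) := by
      have := pot_le hf.good R (r • e0) (by rw [norm_se0 r hr0]; exact hrR) (se0_ne r hr0)
      rwa [norm_se0 r hr0] at this
    have h2 : ℓ / (2 * r ^ 2) ≤ c / 2 / r := by
      rw [div_div, div_le_div_iff₀ (by positivity) (by positivity)]; nlinarith
    have h3 : c / 2 / r ≤ 0 - psiPot (phiRad f) ℓ r := by
      unfold psiPot
      have : c / r = c / 2 / r + c / 2 / r := by ring
      linarith
    apply ENNReal.ofReal_le_ofReal
    apply Real.le_sqrt_of_sq_le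
    rw [mul_pow, Real.sq_sqrt (by positivity)]
    refine le_trans ?_ (le_max_left _ _)
    refine le_trans ?_ h3
    rw [inv_pow, ← div_eq_mul_inv]
    gcongr
    nlinarith
  have hinf : ∫⁻ r in Ioi R1, ENNReal.ofReal (√(c / 2) * r⁻¹) = ⊤ := by
    by_contra hcon
    apply not_integrableOn_Ioi_inv (a := R1)
    have : IntegrableOn (fun r : ℝ => √(c / 2) * r⁻¹) (Ioi R1) := by
      refine ⟨by apply Measurable.aestronglyMeasurable; fun_prop, ?_⟩
      rw [hasFiniteIntegral_iff_ofReal]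
      · exact lt_top_iff_ne_top.2 hcon
      · filter_upwards [ae_restrict_mem measurableSet_Ioi] with r hr
        have : 0 < r := lt_of_lt_of_le (by linarith) (le_of_lt hr)
        simp only [Pi.zero_apply]; positivity
    have h2 := this.const_mul ((√(c / 2))⁻¹)
    refine h2.congr (ae_of_all _ fun r => ?_)
    have : √(c / 2) ≠ 0 := (Real.sqrt_pos.2 (by positivity)).ne'
    field_simp
  rw [← hinf]
  refine (setLIntegral_mono' measurableSet_Ioi hb).trans ?_
  exact lintegral_mono_set (Ioi_subset_Ioi (by linarith))

lemma EE_hyp {f : Phase → ℝ} (hf : memErad f) (hf0 : ¬ f =ᵐ[volume] (0 : Phase → ℝ)) (ℓ : ℝ) (hl : 0 < ℓ) :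
    EHyp lam (EE f ℓ) := by
  refine ⟨EE_meas hf ℓ, ?_, lam_EE_inf hf hf0 ℓ hl, ?_, ?_⟩
  · intro e he
    rw [← lam_aPot hf ℓ e hl he]
    exact ENNReal.ofReal_ne_top
  · intro e _
    rw [lam_apply _ (measurableSet_eq_fun (EE_meas hf ℓ) measurable_const)]
    have : ∀ r, volume (Prod.mk r ⁻¹' {p | EE f ℓ p = e}) = 0 := by
      intro r
      refine measure_mono_null (t := {√(2 * (e - psiPot (phiRad f) ℓ r)), -√(2 * (e - psiPot (phiRad f) ℓ r))}) ?_
        (Set.Finite.measure_zero (by simp) _)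
      intro w hw
      simp only [mem_preimage, mem_ofPred_eq, EE] at hw
      have h1 : 2 * (e - psiPot (phiRad f) ℓ r) = w ^ 2 := by linarith
      rw [h1, Real.sqrt_sq_eq_abs]
      rcases abs_choice w with h | h <;> rw [h] <;> simp
    simp_rw [this, lintegral_zero, mul_zero]
  · obtain ⟨C, hC, hlow⟩ := pot_lower hf.good
    refine ⟨C, hC, fun p => ?_⟩
    have h1 : -C ≤ phiRad f p.1 := hlow _
    have h2 : 0 ≤ ℓ / (2 * p.1 ^ 2) := by positivity
    unfold EE psiPot
    nlinarith [sq_nonneg p.2]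


lemma microE_meas {f : Phase → ℝ} (hf : memErad f) : Measurable (microE f) := by
  have h1 : Measurable fun z : Phase => phiF f z.1 := by
    rw [phiF_pot]; exact (pot_meas hf.good).comp measurable_fst
  unfold microE
  fun_prop

lemma ellOf_meas : Measurable ellOf := by
  unfold ellOf
  have : Measurable fun z : Phase => (inner ℝ z.1 z.2 : ℝ) := measurable_fst.inner measurable_snd
  fun_prop

lemma microE_inv {f : Phase → ℝ} (hf : memErad f) : PInv (microE f) := by
  intro z z' h1 h2 _
  unfold microE
  rw [phiF_pot, pot_rad hf.good _ _ h1, h2]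

lemma ellOf_inv : PInv ellOf := by
  intro z z' h1 h2 h3
  unfold ellOf
  rw [h1, h2, h3]

lemma aPot_comp {α : Type*} [MeasurableSpace α] {f : Phase → ℝ} (hf : memErad f) {a b : α → ℝ} (ha : Measurable a) (hb : Measurable b) :
    Measurable fun x => aPot (phiRad f) (a x) (b x) := by
  have h1 := aPot_meas hf
  have h2 : Measurable fun x => (a x, b x) := ha.prodMk hb
  have h3 := h1.comp h2
  simpa only [Function.comp_def] using h3

lemma schwarz_comp {α : Type*} [MeasurableSpace α] {f : Phase → ℝ} (hf : Measurable f) {a b : α → ℝ} (ha : Measurable a) (hb : Measurable b) :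
    Measurable fun x => schwarz f (a x) (b x) := by
  have h1 := schwarz_meas f hf
  have h2 : Measurable fun x => (a x, b x) := ha.prodMk hb
  have h3 := h1.comp h2
  simpa only [Function.comp_def] using h3

lemma rearr_meas {f : Phase → ℝ} (hf : memErad f) : Measurable (rearr f f) := by
  unfold rearr
  have hE := microE_meas hf
  have hl := ellOf_meas
  have ha : Measurable fun z : Phase => aPot (phiRad f) (microE f z) (ellOf z) :=
    aPot_comp hf hE hl
  have hs : Measurable fun z : Phase => schwarz f (aPot (phiRad f) (microE f z) (ellOf z)) (ellOf z) :=
    schwarz_comp hf.1.1 ha hl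
  exact Measurable.ite (measurableSet_lt hE measurable_const) hs measurable_const

lemma rearr_nonneg (f : Phase → ℝ) (z : Phase) : 0 ≤ rearr f f z := by
  unfold rearr
  split_ifs
  · exact schwarz_nonneg _ _ _
  · exact le_rfl

lemma rearr_inv {f : Phase → ℝ} (hf : memErad f) : PInv (rearr f f) := by
  intro z z' h1 h2 h3
  unfold rearr
  rw [microE_inv hf z z' h1 h2 h3, ellOf_inv z z' h1 h2 h3]

lemma fiber_main {f : Phase → ℝ} (hf : memErad f) (hf0 : ¬ f =ᵐ[volume] (0 : Phase → ℝ)) :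
    ∀ᵐ ℓ ∂(volume.restrict (Ioi (0:ℝ))),
      (∀ s > 0, lam {p | s < rearr f f (PP p ℓ)} = lam {p | s < f (PP p ℓ)}) ∧
      (∫⁻ p, ENNReal.ofReal (rearr f f (PP p ℓ)) ∂lam = ∫⁻ p, ENNReal.ofReal (f (PP p ℓ)) ∂lam) ∧
      (∫⁻ p, ENNReal.ofReal (- microE f (PP p ℓ)) * ENNReal.ofReal (f (PP p ℓ)) ∂lam ≤
        ∫⁻ p, ENNReal.ofReal (- microE f (PP p ℓ)) * ENNReal.ofReal (rearr f f (PP p ℓ)) ∂lam) ∧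
      (∫⁻ p, ENNReal.ofReal (- microE f (PP p ℓ)) * ENNReal.ofReal (f (PP p ℓ)) ∂lam =
        ∫⁻ p, ENNReal.ofReal (- microE f (PP p ℓ)) * ENNReal.ofReal (rearr f f (PP p ℓ)) ∂lam →
        (fun p => f (PP p ℓ)) =ᵐ[lam] fun p => rearr f f (PP p ℓ)) := by
  have hm := hf.1.1
  have hn := hf.1.2.1
  obtain ⟨C, hC, hb⟩ := hf.bdd
  have hmF : Measurable fun z => ENNReal.ofReal (f z) := by fun_prop
  have hfin : ∀ᵐ ℓ ∂(volume.restrict (Ioi (0:ℝ))), ∫⁻ p, ENNReal.ofReal (f (PP p ℓ)) ∂lam < ⊤ := by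
    apply ae_lt_top
    · exact Measurable.lintegral_prod_right' (f := fun q : ℝ × (ℝ × ℝ) => ENNReal.ofReal (f (PP q.2 q.1))) (hmF.comp PP_meas)
    · rw [← lint_phase _ hmF (hf.2.inv.comp _)]
      exact hf.fin
  have hz : ∀ᵐ ℓ ∂(volume.restrict (Ioi (0:ℝ))), lam {p | C < f (PP p ℓ)} = 0 := by
    have hS : MeasurableSet {z | C < f z} := measurableSet_lt measurable_const hm
    have hmI : Measurable ({z | C < f z}.indicator (1 : Phase → ℝ≥0∞)) := measurable_one.indicator hS
    have hi : PInv ({z | C < f z}.indicator (1 : Phase → ℝ≥0∞)) := by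
      intro z z' h1 h2 h3
      have := hf.2.inv z z' h1 h2 h3
      simp [indicator, this]
    have h0 : ∫⁻ z, {z | C < f z}.indicator (1 : Phase → ℝ≥0∞) z = 0 := by
      rw [lintegral_indicator_one hS]
      rw [ae_iff] at hb
      simpa using hb
    rw [lint_phase _ hmI hi] at h0
    rw [lintegral_eq_zero_iff (Measurable.lintegral_prod_right' (f := fun q : ℝ × (ℝ × ℝ) => {z | C < f z}.indicator (1 : Phase → ℝ≥0∞) (PP q.2 q.1)) (hmI.comp PP_meas))] at h0
    filter_upwards [h0] with ℓ h
    have hS' : MeasurableSet {p : ℝ × ℝ | C < f (PP p ℓ)} := measurableSet_lt measurable_const (hm.comp (PP_meas' ℓ))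
    rw [← lintegral_indicator_one hS']
    exact h
  filter_upwards [hfin, hz, ae_restrict_mem measurableSet_Ioi] with ℓ h1 h2 hl
  have hl : 0 < ℓ := hl
  have hH := EE_hyp hf hf0 ℓ hl
  let G : ℝ × ℝ → ℝ := fun p => if EE f ℓ p < 0 then schwarz f (aPot (phiRad f) (EE f ℓ p) ℓ) ℓ else 0
  have hGn : ∀ p, 0 ≤ G p := by
    intro p; simp only [G]; split_ifs
    · exact schwarz_nonneg _ _ _
    · exact le_rfl
  have hGm : Measurable G := by
    have hE := EE_meas hf ℓ
    have ha : Measurable fun p : ℝ × ℝ => aPot (phiRad f) (EE f ℓ p) ℓ :=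
      aPot_comp hf hE measurable_const
    have hs : Measurable fun p : ℝ × ℝ => schwarz f (aPot (phiRad f) (EE f ℓ p) ℓ) ℓ :=
      schwarz_comp hf.1.1 ha measurable_const
    exact Measurable.ite (measurableSet_lt hE measurable_const) hs measurable_const
  have hae : ∀ᵐ p ∂lam, rearr f f (PP p ℓ) = G p := by
    filter_upwards [lam_ae] with p hp
    unfold rearr
    rw [EE_eq f ℓ hl, PP_ell p ℓ hp hl]
  have hrel : ∀ s > 0, ∀ p, s < G p ↔ EE f ℓ p < 0 ∧ lam {q | EE f ℓ q < EE f ℓ p} < lam {q | s < f (PP q ℓ)} := by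
    intro s hs p
    simp only [G]
    by_cases h : EE f ℓ p < 0
    · rw [if_pos h, lt_schwarz_iff f _ ℓ s C hs.le (by rw [muDist_eq f hm C ℓ hl]; exact h2), lam_aPot hf ℓ _ hl h,
        muDist_eq f hm s ℓ hl]
      tauto
    · rw [if_neg h]
      constructor
      · intro h'; exact absurd h' (not_lt.2 hs.le)
      · intro h'; exact absurd h'.1 h
  obtain ⟨a, b, c, d⟩ := fiber hH (F := fun p => f (PP p ℓ)) (G := G) (hm.comp (PP_meas' ℓ)) hGm (fun p => hn _) hGn h1.ne hrel
  have e1 : ∀ s : ℝ, lam {p | s < rearr f f (PP p ℓ)} = lam {p | s < G p} := by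
    intro s
    apply measure_congr
    filter_upwards [hae] with p hp
    apply propext
    change s < rearr f f (PP p ℓ) ↔ s < G p
    rw [hp]
  have e2 : ∫⁻ p, ENNReal.ofReal (rearr f f (PP p ℓ)) ∂lam = ∫⁻ p, ENNReal.ofReal (G p) ∂lam := by
    apply lintegral_congr_ae
    filter_upwards [hae] with p hp
    rw [hp]
  simp_rw [EE_eq f ℓ hl]
  have e3 : ∫⁻ p, ENNReal.ofReal (- EE f ℓ p) * ENNReal.ofReal (rearr f f (PP p ℓ)) ∂lam = ∫⁻ p, ENNReal.ofReal (- EE f ℓ p) * ENNReal.ofReal (G p) ∂lam := by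
    apply lintegral_congr_ae
    filter_upwards [hae] with p hp
    rw [hp]
  rw [e2, e3]
  refine ⟨fun s hs => (e1 s).trans (a s hs), b, c, fun hh => ?_⟩
  filter_upwards [d hh, hae] with p hp hp'
  rw [hp, hp']

lemma rearr_mem {f : Phase → ℝ} (hf : memErad f) (hf0 : ¬ f =ᵐ[volume] (0 : Phase → ℝ)) : memErad (rearr f f) := by
  have hm := rearr_meas hf
  have hfib := fiber_main hf hf0
  have hmass : ∫⁻ z, ENNReal.ofReal (rearr f f z) = ∫⁻ z, ENNReal.ofReal (f z) := by
    rw [lint_phase (fun z => ENNReal.ofReal (rearr f f z)) (by fun_prop) ((rearr_inv hf).comp _),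
      lint_phase (fun z => ENNReal.ofReal (f z)) hf.1.1.ennreal_ofReal (hf.2.inv.comp _)]
    apply lintegral_congr_ae
    filter_upwards [hfib] with ℓ h
    exact h.2.1
  have hfin : ∫⁻ z, ENNReal.ofReal (rearr f f z) ≠ ⊤ := by rw [hmass]; exact hf.fin
  obtain ⟨C, hC, hb⟩ := hf.bdd
  refine memErad_of hm (rearr_nonneg f) (rearr_inv hf).sph hfin (C + 1) ?_ ?_
  · have key : ∀ g : Phase → ℝ, Measurable g → PInv g → volume {z | C + 1 < g z} = ∫⁻ ℓ in Ioi (0:ℝ), lam {p | C + 1 < g (PP p ℓ)} := by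
      intro g hg hgi
      have hS : MeasurableSet {z | C + 1 < g z} := measurableSet_lt measurable_const hg
      rw [← lintegral_indicator_one hS, lint_phase _ (measurable_one.indicator hS)]
      · refine lintegral_congr fun ℓ => ?_
        have hS' : MeasurableSet {p : ℝ × ℝ | C + 1 < g (PP p ℓ)} := measurableSet_lt measurable_const (hg.comp (PP_meas' ℓ))
        rw [← lintegral_indicator_one hS']
        rfl
      · intro z z' h1 h2 h3
        have := hgi z z' h1 h2 h3
        simp [indicator, this]
    have hz : volume {z | C + 1 < rearr f f z} = volume {z | C + 1 < f z} := by
      rw [key _ hm (rearr_inv hf), key _ hf.1.1 hf.2.inv]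
      apply lintegral_congr_ae
      filter_upwards [hfib] with ℓ h
      exact h.1 (C + 1) (by linarith)
    rw [ae_iff]
    simp only [not_le]
    rw [hz]
    refine measure_mono_null ?_ (ae_iff.1 hb)
    intro z hz
    simp only [mem_ofPred_eq] at hz ⊢
    linarith
  · obtain ⟨D, hD, hlow⟩ := pot_lower hf.good
    refine ne_top_of_le_ne_top (ENNReal.mul_ne_top (ENNReal.ofReal_ne_top (r := 2 * D)) hfin) ?_
    rw [← lintegral_const_mul' _ _ ENNReal.ofReal_ne_top]
    refine lintegral_mono fun z => ?_
    by_cases h : microE f z < 0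
    · gcongr
      have h1 : -D ≤ phiF f z.1 := hlow _
      unfold microE at h
      linarith
    · have : rearr f f z = 0 := by unfold rearr; rw [if_neg h]
      simp [this]

/-- negative part of the energy paired with g -/
lemma Kint {f g : Phase → ℝ} (hf : memErad f) (hg : memErad g) :
    Integrable (fun z => max (- microE f z) 0 * g z) := by
  obtain ⟨D, hD, hlow⟩ := pot_lower hf.good
  have hE := microE_meas hf
  refine hg.int.bdd_mul (c := D) (by apply Measurable.aestronglyMeasurable; fun_prop) (ae_of_all _ fun z => ?_)
  rw [Real.norm_of_nonneg (le_max_right _ _)]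
  apply max_le _ hD
  have h1 : -D ≤ phiF f z.1 := hlow _
  unfold microE
  nlinarith [sq_nonneg ‖z.2‖]

lemma Klint {f g : Phase → ℝ} (hf : memErad f) (hg : memErad g) :
    ENNReal.ofReal (∫ z, max (- microE f z) 0 * g z) = ∫⁻ z, ENNReal.ofReal (- microE f z) * ENNReal.ofReal (g z) := by
  rw [ofReal_integral_eq_lintegral_ofReal (Kint hf hg) (ae_of_all _ fun z => mul_nonneg (le_max_right _ _) (hg.1.2.1 z))]
  refine lintegral_congr fun z => ?_
  rw [ENNReal.ofReal_mul (le_max_right _ _)]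
  congr 1
  simp [ENNReal.ofReal_max]

lemma Klint_phase {f g : Phase → ℝ} (hf : memErad f) (hg : memErad g) :
    ∫⁻ z, ENNReal.ofReal (- microE f z) * ENNReal.ofReal (g z) =
      ∫⁻ ℓ in Ioi (0:ℝ), ∫⁻ p, ENNReal.ofReal (- microE f (PP p ℓ)) * ENNReal.ofReal (g (PP p ℓ)) ∂lam := by
  have hE := microE_meas hf
  have hm := hg.1.1
  refine lint_phase (fun z => ENNReal.ofReal (- microE f z) * ENNReal.ofReal (g z)) (by fun_prop) ?_
  intro z z' h1 h2 h3
  simp only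
  rw [microE_inv hf z z' h1 h2 h3, hg.2.inv z z' h1 h2 h3]

lemma ham_congr {f g : Phase → ℝ} (h : f =ᵐ[volume] g) : Ham f = Ham g := by
  have hr : rhoF f =ᵐ[volume] rhoF g := by
    rw [Measure.volume_eq_prod] at h
    have := Measure.ae_ae_of_ae_prod h
    filter_upwards [this] with x hx
    exact integral_congr_ae hx
  have hp : phiF f = phiF g := by
    funext x
    unfold phiF
    congr 1
    apply integral_congr_ae
    filter_upwards [hr] with y hy
    rw [hy]
  unfold Ham kineticE fieldSq gradPhi
  rw [hp]
  congr 2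
  apply integral_congr_ae
  filter_upwards [h] with z hz
  rw [hz]

/-- Monotonicity of the Hamiltonian under the rearrangement `f ↦ f^{*φ_f}`. -/
theorem stmt16 (f : Phase → ℝ) (hf : memErad f)
    (hf0 : ¬ f =ᵐ[volume] (0 : Phase → ℝ)) :
    Ham f ≥ Jred f f ∧
    Jred f f ≥ Ham (rearr f f) ∧
    (Ham f = Ham (rearr f f) ↔ f =ᵐ[volume] rearr f f) := by

  have hg := rearr_mem hf hf0
  have hfib := fiber_main hf hf0
  have hle : ∫⁻ z, ENNReal.ofReal (- microE f z) * ENNReal.ofReal (f z) ≤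
      ∫⁻ z, ENNReal.ofReal (- microE f z) * ENNReal.ofReal (rearr f f z) := by
    rw [Klint_phase hf hf, Klint_phase hf hg]
    apply lintegral_mono_ae
    filter_upwards [hfib] with ℓ h
    exact h.2.2.1
  have hfinK : ∫⁻ z, ENNReal.ofReal (- microE f z) * ENNReal.ofReal (f z) ≠ ⊤ := by
    rw [← Klint hf hf]; exact ENNReal.ofReal_ne_top
  have hKnn : ∀ g : Phase → ℝ, memErad g → 0 ≤ ∫ z, max (- microE f z) 0 * g z := fun g hg =>
    integral_nonneg fun z => mul_nonneg (le_max_right _ _) (hg.1.2.1 z)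
  have hKle : ∫ z, max (- microE f z) 0 * f z ≤ ∫ z, max (- microE f z) 0 * rearr f f z := by
    rw [← Klint hf hf, ← Klint hf hg] at hle
    exact (ENNReal.ofReal_le_ofReal_iff (hKnn _ hg)).1 hle
  have h1 : - (∫ z, max (- microE f z) 0 * f z) ≤ ∫ z, microE f z * f z := by
    rw [← integral_neg]
    refine integral_mono (Kint hf hf).neg (microE_int hf hf) fun z => ?_
    have := hf.1.2.1 z
    have h2 := le_max_left (- microE f z) 0
    simp only
    nlinarith
  have h2 : ∫ z, microE f z * rearr f f z = - ∫ z, max (- microE f z) 0 * rearr f f z := by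
    rw [← integral_neg]
    refine integral_congr_ae (ae_of_all _ fun z => ?_)
    simp only
    by_cases h : microE f z < 0
    · rw [max_eq_left (by linarith)]; ring
    · have : rearr f f z = 0 := by unfold rearr; rw [if_neg h]
      simp [this]
  have hHf : Ham f = (∫ z, microE f z * f z) + fieldSq f / 2 := by
    rw [← ham_id hf hf]; simp
  have hJ : Jred f f = (∫ z, microE f z * rearr f f z) + fieldSq f / 2 := by
    rw [← ham_id hf hg]; rfl
  have c1 : Jred f f ≤ Ham f := by rw [hHf, hJ]; linarith
  have c2 : Ham (rearr f f) ≤ Jred f f := by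
    unfold Jred
    have : 0 ≤ ∫ x : E3, ‖gradPhi f x - gradPhi (rearr f f) x‖ ^ 2 := integral_nonneg fun x => by positivity
    linarith
  refine ⟨c1, c2, fun heq => ?_, fun h => ham_congr h⟩
  have hKeq : ∫ z, max (- microE f z) 0 * f z = ∫ z, max (- microE f z) 0 * rearr f f z := by
    apply le_antisymm hKle
    linarith
  have hLeq : ∫⁻ z, ENNReal.ofReal (- microE f z) * ENNReal.ofReal (f z) =
      ∫⁻ z, ENNReal.ofReal (- microE f z) * ENNReal.ofReal (rearr f f z) := by
    rw [← Klint hf hf, ← Klint hf hg, hKeq]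
  rw [Klint_phase hf hf] at hLeq hfinK
  rw [Klint_phase hf hg] at hLeq
  have hE := microE_meas hf
  have hm := hf.1.1
  have hgm := hg.1.1
  have hae := ae_eq_of_ae_le_of_lintegral_le (μ := volume.restrict (Ioi (0:ℝ)))
    (f := fun ℓ => ∫⁻ p, ENNReal.ofReal (- microE f (PP p ℓ)) * ENNReal.ofReal (f (PP p ℓ)) ∂lam)
    (g := fun ℓ => ∫⁻ p, ENNReal.ofReal (- microE f (PP p ℓ)) * ENNReal.ofReal (rearr f f (PP p ℓ)) ∂lam)
    (by filter_upwards [hfib] with ℓ h using h.2.2.1) hfinK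
    (by
      have hmm : Measurable fun z => ENNReal.ofReal (- microE f z) * ENNReal.ofReal (rearr f f z) := by fun_prop
      exact (Measurable.lintegral_prod_right' (hmm.comp PP_meas)).aemeasurable) hLeq.symm.le
  have hmd : Measurable fun z => ENNReal.ofReal |f z - rearr f f z| := by
    have : Measurable fun z => |f z - rearr f f z| := measurable_norm.comp (hm.sub hgm)
    exact this.ennreal_ofReal
  have hzero : ∫⁻ z, ENNReal.ofReal |f z - rearr f f z| = 0 := by
    rw [lint_phase (fun z => ENNReal.ofReal |f z - rearr f f z|) hmd (by
      intro z z' h1 h2 h3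
      simp only
      rw [hf.2.inv z z' h1 h2 h3, hg.2.inv z z' h1 h2 h3])]
    rw [← lintegral_zero (μ := volume.restrict (Ioi (0:ℝ)))]
    apply lintegral_congr_ae
    filter_upwards [hae, hfib] with ℓ h h'
    have h3 := h'.2.2.2 h
    rw [← lintegral_zero (μ := lam)]
    apply lintegral_congr_ae
    filter_upwards [h3] with p hp
    rw [hp]; simp
  rw [lintegral_eq_zero_iff hmd] at hzero
  filter_upwards [hzero] with z hz
  simp only [Pi.zero_apply, ENNReal.ofReal_eq_zero] at hz
  have := abs_nonpos_iff.1 hz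
  linarith
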